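/- (Weil bound, mixed character sum) Let p be a prime and let χ be a nontrivial multiplicative character of F_p of order s (extended by χ(0) = 0). Suppose G(X) ∈ F_p[X] is nonzero and is not, up to a nonzero multiplicative constant, an s-th power in F_p[X], and let ν be the number of distinct roots of G in an algebraic closure of F_p. Then for any polynomial F(X) ∈ F_p[X] of degree d with 0 ≤ d < p: |Σ_{u ∈ F_p} e_p(F(u)) χ(G(u))| ≤ (d + ν − 1) p^{1/2}. -/

import Mathlib

/-- `e_m(z) = exp(2 π i z / m)` for `z ∈ ZMod m` (represented by an integer in `[0, m-1]`). -/
noncomputable def eZMod (m : ℕ) (z : ZMod m) : ℂ :=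
  Complex.exp (2 * Real.pi * Complex.I * (z.val : ℂ) / m)

open Polynomial in
/-- If the even power sums of finitely many complex numbers `ω i` grow at most like `B ^ m`, then
each `‖ω i‖ ^ 2` is at most `B`. -/
theorem norm_sq_le_of_powerSum_bound {ι : Type*} [Fintype ι] (ω : ι → ℂ) {B C : ℝ} (hB : 0 < B)
    (m₀ : ℕ) (h : ∀ m ≥ m₀, ‖∑ i, ω i ^ (2 * m)‖ ≤ C * B ^ m) (i : ι) : ‖ω i‖ ^ 2 ≤ B := by
  classical
  set α : ι → ℂ := fun i ↦ ω i ^ 2 with hα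
  set S : Finset ℂ := (Finset.univ.image α).erase (α i) with hS
  set P : ℂ[X] := ∏ β ∈ S, (X - Polynomial.C β) with hP
  have hPi : P.eval (α i) ≠ 0 := by
    rw [hP, eval_prod, Finset.prod_ne_zero_iff]
    intro β hβ
    have := Finset.ne_of_mem_erase hβ
    simpa [sub_eq_zero] using this.symm
  have hPj : ∀ j, α j ≠ α i → P.eval (α j) = 0 := by
    intro j hj
    rw [hP, eval_prod]
    exact Finset.prod_eq_zero (i := α j) (by simp [hS, hj]) (by simp)
  set N : ℕ := (Finset.univ.filter fun j ↦ α j = α i).card with hN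
  have hN1 : 1 ≤ N := Finset.card_pos.mpr ⟨i, by simp⟩
  have key : ∀ m, ∑ k ∈ P.support, P.coeff k * ∑ j, ω j ^ (2 * (m + k))
      = N * (α i ^ m * P.eval (α i)) := by
    intro m
    calc _ = ∑ j, α j ^ m * P.eval (α j) := by
          simp_rw [eval_eq_sum, Polynomial.sum, Finset.mul_sum]
          rw [Finset.sum_comm]
          refine Finset.sum_congr rfl fun j _ ↦ Finset.sum_congr rfl fun k _ ↦ ?_
          rw [pow_mul, pow_add]
          ring
      _ = ∑ j, if α j = α i then α i ^ m * P.eval (α i) else 0 := by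
          refine Finset.sum_congr rfl fun j _ ↦ ?_
          split_ifs with hj
          · rw [hj]
          · rw [hPj j hj, mul_zero]
      _ = _ := by
          rw [← Finset.sum_filter, Finset.sum_const, nsmul_eq_mul]
  set C' : ℝ := (∑ k ∈ P.support, ‖P.coeff k‖ * (|C| * B ^ k)) / ‖P.eval (α i)‖ with hC'
  have hpos : 0 < ‖P.eval (α i)‖ := norm_pos_iff.mpr hPi
  have hbound : ∀ m ≥ m₀, (‖α i‖ / B) ^ m ≤ C' := by
    intro m hm
    rw [div_pow, hC', div_le_div_iff₀ (by positivity) hpos]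
    calc ‖α i‖ ^ m * ‖P.eval (α i)‖ ≤ N * (‖α i‖ ^ m * ‖P.eval (α i)‖) :=
          le_mul_of_one_le_left (by positivity) (by exact_mod_cast hN1)
      _ = ‖∑ k ∈ P.support, P.coeff k * ∑ j, ω j ^ (2 * (m + k))‖ := by
          rw [key]; simp
      _ ≤ ∑ k ∈ P.support, ‖P.coeff k‖ * (|C| * B ^ (m + k)) := by
          refine (norm_sum_le _ _).trans (Finset.sum_le_sum fun k _ ↦ ?_)
          rw [norm_mul]
          gcongr
          refine (h _ (by omega)).trans ?_
          gcongr
          exact le_abs_self C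
      _ = _ := by
          rw [Finset.sum_mul]
          refine Finset.sum_congr rfl fun k _ ↦ ?_
          rw [pow_add]; ring
  by_contra! hlt
  have h1 : 1 < ‖α i‖ / B := by rw [one_lt_div hB]; simpa [hα] using hlt
  obtain ⟨n, hn⟩ := pow_unbounded_of_one_lt C' h1
  have h2 := hbound (max n m₀) (le_max_right _ _)
  have h3 := pow_le_pow_right₀ h1.le (le_max_left n m₀)
  linarith

open Polynomial in
/-- A sequence `c` with `c 0 = 1` vanishing beyond `D` is, up to signs, the sequence of elementary
symmetric functions of `D` complex numbers; the logarithmic-derivative recurrence then identifies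
`S` with minus the power sums of these numbers. -/
theorem exists_powerSum_of_recurrence (c S : ℕ → ℂ) (D : ℕ) (h0 : c 0 = 1)
    (hD : ∀ n, D < n → c n = 0)
    (hrec : ∀ n : ℕ, (n : ℂ) * c n = ∑ k ∈ Finset.range n, c k * S (n - k)) :
    ∃ W : Multiset ℂ, W.card = D ∧ ∀ n, 0 < n → S n = -∑ w : W, (w : ℂ) ^ n := by
  set f : ℂ[X] := ∑ n ∈ Finset.range (D + 1), monomial (D - n) (c n) with hf
  have hcoeff : ∀ k ≤ D, f.coeff k = c (D - k) := by
    intro k hk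
    rw [hf, finsetSum_coeff, Finset.sum_eq_single (D - k)]
    · rw [coeff_monomial, if_pos (by omega)]
    · intro b hb hne
      rw [coeff_monomial, if_neg]
      have := Finset.mem_range.mp hb
      omega
    · intro hnot
      exact absurd (Finset.mem_range.mpr (by omega)) hnot
  have hdeg : f.natDegree ≤ D := by
    rw [hf]
    refine natDegree_sum_le_of_forall_le _ _ fun n _ ↦ (natDegree_monomial_le _).trans (by omega)
  have hmonic : f.Monic := monic_of_natDegree_le_of_coeff_eq_one D hdeg
    (by rw [hcoeff D le_rfl, Nat.sub_self, h0])
  have hdeg' : f.natDegree = D := by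
    refine le_antisymm hdeg (le_natDegree_of_ne_zero ?_)
    rw [hcoeff D le_rfl, Nat.sub_self, h0]; exact one_ne_zero
  have hcard : f.roots.card = f.natDegree :=
    (splits_iff_card_roots.mp (IsAlgClosed.splits f))
  refine ⟨f.roots, hcard.trans hdeg', ?_⟩
  set W := f.roots with hW
  have hWcard : Fintype.card W = D := by rw [Multiset.card_coe, hcard, hdeg']
  set e : ℕ → ℂ := fun n ↦ MvPolynomial.aeval (fun w : W ↦ (w : ℂ)) (MvPolynomial.esymm W ℂ n)
    with he
  have hce : ∀ n, c n = (-1) ^ n * e n := by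
    intro n
    have hen : e n = W.esymm n := by
      rw [he]
      simp only [MvPolynomial.aeval_esymm_eq_multiset_esymm]
      rw [Multiset.map_univ_coe]
    rcases le_or_gt n D with hn | hn
    · have := Polynomial.coeff_eq_esymm_roots_of_card hcard (k := D - n) (by omega)
      rw [hcoeff _ (by omega), hmonic.leadingCoeff, hdeg', one_mul, Nat.sub_sub_self hn] at this
      rw [this, hen]
    · rw [hD n hn, hen, Multiset.esymm, Multiset.powersetCard_eq_empty _ (by omega)]
      simp
  intro n
  induction n using Nat.strong_induction_on with
  | _ n ih =>
    intro hn
    have hN := congrArg (MvPolynomial.aeval (fun w : W ↦ (w : ℂ)))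
      (MvPolynomial.mul_esymm_eq_sum W ℂ n)
    simp only [map_mul, map_natCast, map_sum, map_pow, map_neg, map_one] at hN
    have hsum : ∀ m, MvPolynomial.aeval (fun w : W ↦ (w : ℂ)) (MvPolynomial.psum W ℂ m)
        = ∑ w : W, (w : ℂ) ^ m := by
      intro m; simp [MvPolynomial.psum]
    have hN' : (n : ℂ) * c n = ∑ k ∈ Finset.range n, c k * (-∑ w : W, (w : ℂ) ^ (n - k)) := by
      have h1 : (n : ℂ) * c n = (-1) ^ n * (n * e n) := by rw [hce]; ring
      rw [h1, he]
      simp only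
      rw [hN, Finset.sum_filter, Finset.Nat.sum_antidiagonal_eq_sum_range_succ_mk,
        Finset.sum_range_succ]
      simp only [lt_irrefl, if_false, add_zero, hsum]
      rw [← mul_assoc, ← pow_add, Odd.neg_one_pow ⟨n, by ring⟩, neg_one_mul, ← Finset.sum_neg_distrib]
      refine Finset.sum_congr rfl fun k hk ↦ ?_
      rw [if_pos (Finset.mem_range.mp hk), hce k, he]
      ring
    have := (hrec n).symm.trans hN'
    obtain ⟨m, rfl⟩ : ∃ m, n = m + 1 := ⟨n - 1, by omega⟩
    rw [Finset.sum_range_succ', Finset.sum_range_succ' (fun k ↦ c k * -_)] at this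
    rw [Finset.sum_congr rfl (g := fun k ↦ c (k + 1) * -∑ w : W, (w : ℂ) ^ (m + 1 - (k + 1)))] at this
    · simpa [h0] using this
    · intro k hk
      have := Finset.mem_range.mp hk
      rw [ih _ (by omega) (by omega)]

open Polynomial in
/-- The monic polynomials of degree `n` over a finite field form a finite set. -/
theorem finite_setOf_monic_natDegree_eq (k : Type*) [Field k] [Finite k] (n : ℕ) :
    {h : k[X] | h.Monic ∧ h.natDegree = n}.Finite := by
  have : Finite (degreeLT k (n + 1)) := (degreeLTEquiv k (n + 1)).toEquiv.finite_iff.mpr inferInstance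
  refine (Set.toFinite (degreeLT k (n + 1) : Set k[X])).subset ?_
  rintro h ⟨hm, hn⟩
  rw [SetLike.mem_coe, mem_degreeLT, degree_eq_natDegree hm.ne_zero, hn]
  exact_mod_cast n.lt_succ_self

/-- The finite set of monic polynomials of degree `n` over a finite field. -/
noncomputable def monicsOfDegree (k : Type*) [Field k] [Finite k] (n : ℕ) :
    Finset (Polynomial k) :=
  (finite_setOf_monic_natDegree_eq k n).toFinset

open Polynomial in
theorem mem_monicsOfDegree {k : Type*} [Field k] [Finite k] {n : ℕ} {h : k[X]} :
    h ∈ monicsOfDegree k n ↔ h.Monic ∧ h.natDegree = n := by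
  simp [monicsOfDegree]

/-- The finite set of monic irreducible polynomials of degree `n` over a finite field. -/
noncomputable def irreduciblesOfDegree (k : Type*) [Field k] [Finite k] (n : ℕ) :
    Finset (Polynomial k) := by
  classical exact (monicsOfDegree k n).filter Irreducible

open Polynomial in
theorem mem_irreduciblesOfDegree {k : Type*} [Field k] [Finite k] {n : ℕ} {h : k[X]} :
    h ∈ irreduciblesOfDegree k n ↔ h.Monic ∧ h.natDegree = n ∧ Irreducible h := by
  classical
  simp [irreduciblesOfDegree, mem_monicsOfDegree, and_assoc]

open Polynomial in
/-- The degree of a monic polynomial counts the prime powers dividing it, weighted by the degrees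
of the primes. -/
theorem natDegree_eq_sum_prime_pow_dvd {k : Type*} [Field k] [Finite k] {h : k[X]} (hm : h.Monic)
    [DecidablePred fun f : k[X] ↦ f ∣ h] :
    h.natDegree = ∑ m ∈ Finset.Icc 1 h.natDegree, ∑ r ∈ m.divisors,
      ∑ P ∈ irreduciblesOfDegree k r, if P ^ (m / r) ∣ h then r else 0 := by
  classical
  set n := h.natDegree with hn
  have hnf : ∀ P ∈ UniqueFactorizationMonoid.normalizedFactors h, P.Monic ∧ Irreducible P := by
    intro P hP
    have hi := UniqueFactorizationMonoid.irreducible_of_normalized_factor P hP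
    refine ⟨?_, hi⟩
    have := UniqueFactorizationMonoid.normalize_normalized_factor P hP
    rw [← this]
    exact monic_normalize hi.ne_zero
  have h1 : n = ∑ P ∈ (UniqueFactorizationMonoid.normalizedFactors h).toFinset,
      (UniqueFactorizationMonoid.normalizedFactors h).count P * P.natDegree := by
    have hprod : (UniqueFactorizationMonoid.normalizedFactors h).prod = h := by
      have := UniqueFactorizationMonoid.prod_normalizedFactors_eq hm.ne_zero
      rwa [hm.normalize_eq_self] at this
    conv_lhs => rw [hn, ← hprod]
    rw [natDegree_multiset_prod_of_monic _ (fun P hP ↦ (hnf P hP).1),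
      Finset.sum_multiset_map_count]
    simp
  have h2 : ∑ P ∈ (UniqueFactorizationMonoid.normalizedFactors h).toFinset,
      (UniqueFactorizationMonoid.normalizedFactors h).count P * P.natDegree =
      ∑ r ∈ Finset.Icc 1 n, ∑ P ∈ irreduciblesOfDegree k r,
        (UniqueFactorizationMonoid.normalizedFactors h).count P * r := by
    rw [← Finset.sum_fiberwise_of_maps_to (t := Finset.Icc 1 n) (g := fun P ↦ P.natDegree)]
    · refine Finset.sum_congr rfl fun r _ ↦ ?_
      refine (Finset.sum_congr rfl fun P hP ↦ ?_).trans (Finset.sum_subset ?_ ?_)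
      · rw [(Finset.mem_filter.mp hP).2]
      · intro P hP
        obtain ⟨hP1, hP2⟩ := Finset.mem_filter.mp hP
        have := hnf P (Multiset.mem_toFinset.mp hP1)
        exact mem_irreduciblesOfDegree.mpr ⟨this.1, hP2, this.2⟩
      · intro P hP hP'
        rw [Multiset.count_eq_zero_of_notMem, zero_mul]
        intro hmem
        exact hP' (Finset.mem_filter.mpr ⟨Multiset.mem_toFinset.mpr hmem,
          (mem_irreduciblesOfDegree.mp hP).2.1⟩)
    · intro P hP
      have hP' := Multiset.mem_toFinset.mp hP
      exact Finset.mem_Icc.mpr ⟨(hnf P hP').2.natDegree_pos,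
        natDegree_le_of_dvd (UniqueFactorizationMonoid.dvd_of_mem_normalizedFactors hP') hm.ne_zero⟩
  have h3 : ∀ r ∈ Finset.Icc 1 n, ∀ P ∈ irreduciblesOfDegree k r,
      (UniqueFactorizationMonoid.normalizedFactors h).count P * r =
      ∑ m ∈ (Finset.Icc 1 n).filter (fun m ↦ r ∣ m), if P ^ (m / r) ∣ h then r else 0 := by
    intro r hr P hP
    obtain ⟨hPm, hPr, hPi⟩ := mem_irreduciblesOfDegree.mp hP
    have hr1 := (Finset.mem_Icc.mp hr).1
    have hcount : ∀ j, P ^ j ∣ h ↔ j ≤ (UniqueFactorizationMonoid.normalizedFactors h).count P := by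
      intro j
      rw [UniqueFactorizationMonoid.dvd_iff_normalizedFactors_le_normalizedFactors
        (pow_ne_zero _ hPi.ne_zero) hm.ne_zero, UniqueFactorizationMonoid.normalizedFactors_pow,
        UniqueFactorizationMonoid.normalizedFactors_irreducible hPi, hPm.normalize_eq_self,
        Multiset.nsmul_singleton, Multiset.le_count_iff_replicate_le]
    rw [← Finset.sum_filter, Finset.sum_const, smul_eq_mul]
    congr 1
    have : (((Finset.Icc 1 n).filter (fun m ↦ r ∣ m)).filter fun m ↦ P ^ (m / r) ∣ h) =
        (Finset.Icc 1 ((UniqueFactorizationMonoid.normalizedFactors h).count P)).image (· * r) := by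
      ext m
      simp only [Finset.mem_filter, Finset.mem_Icc, Finset.mem_image]
      constructor
      · rintro ⟨⟨⟨hm1, hmn⟩, j, rfl⟩, hd⟩
        rw [Nat.mul_div_cancel_left _ hr1, hcount] at hd
        exact ⟨j, ⟨Nat.pos_of_mul_pos_left hm1, hd⟩, mul_comm _ _⟩
      · rintro ⟨j, ⟨hj1, hj2⟩, rfl⟩
        have hd := (hcount j).mpr hj2
        have hle := natDegree_le_of_dvd hd hm.ne_zero
        rw [natDegree_pow, hPr] at hle
        refine ⟨⟨⟨Nat.mul_pos hj1 hr1, hle⟩, Dvd.intro_left j rfl⟩, ?_⟩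
        rwa [Nat.mul_div_cancel _ hr1]
    rw [this, Finset.card_image_of_injective _ (mul_left_injective₀ (by omega : r ≠ 0))]
    simp
  refine (h1.trans h2).trans ?_
  rw [Finset.sum_congr rfl fun r hr ↦ Finset.sum_congr rfl (h3 r hr)]
  have h4 : ∀ m ∈ Finset.Icc 1 n, m.divisors = (Finset.Icc 1 n).filter (fun r ↦ r ∣ m) := by
    intro m hm
    have := Finset.mem_Icc.mp hm
    ext r
    simp only [Nat.mem_divisors, Finset.mem_filter, Finset.mem_Icc]
    constructor
    · rintro ⟨h, -⟩
      exact ⟨⟨Nat.pos_of_dvd_of_pos h (by omega), (Nat.le_of_dvd (by omega) h).trans this.2⟩, h⟩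
    · rintro ⟨-, h⟩
      exact ⟨h, by omega⟩
  refine Eq.trans ?_ (Finset.sum_congr rfl fun m hm ↦ by rw [h4 m hm]).symm
  simp_rw [Finset.sum_filter]
  rw [Finset.sum_comm]
  refine Finset.sum_congr rfl fun r _ ↦ ?_
  rw [Finset.sum_comm]
  refine Finset.sum_congr rfl fun m _ ↦ ?_
  split_ifs
  · rfl
  · simp

open Polynomial in
/-- The recurrence between the coefficients `∑ Λ h` (over monic `h` of degree `n`) of the `L`-series
of a completely multiplicative function `Λ` and those of its logarithmic derivative. -/
theorem natCast_mul_sum_monicsOfDegree {k : Type*} [Field k] [Finite k] (Λ : k[X] → ℂ)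
    (hmul : ∀ f g : k[X], f.Monic → g.Monic → Λ (f * g) = Λ f * Λ g) (h1 : Λ 1 = 1) (n : ℕ) :
    (n : ℂ) * ∑ h ∈ monicsOfDegree k n, Λ h =
      ∑ i ∈ Finset.range n, (∑ h ∈ monicsOfDegree k i, Λ h) *
        ∑ r ∈ (n - i).divisors, ∑ P ∈ irreduciblesOfDegree k r, (r : ℂ) * Λ P ^ ((n - i) / r) := by
  classical
  have hpow : ∀ (P : k[X]) (j : ℕ), P.Monic → Λ (P ^ j) = Λ P ^ j := by
    intro P j hP
    induction j with
    | zero => simpa using h1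
    | succ j ih => rw [pow_succ, pow_succ, hmul _ _ (hP.pow j) hP, ih]
  have hdiv : ∀ (Q : k[X]) (m : ℕ), Q.Monic → Q.natDegree = m → m ≤ n →
      ∑ h ∈ monicsOfDegree k n, (if Q ∣ h then Λ h else 0) =
        Λ Q * ∑ h ∈ monicsOfDegree k (n - m), Λ h := by
    intro Q m hQ hQm hmn
    rw [← Finset.sum_filter, Finset.mul_sum]
    symm
    refine Finset.sum_bij (fun h _ ↦ Q * h) ?_ ?_ ?_ ?_
    · intro h hh
      obtain ⟨ha, hb⟩ := mem_monicsOfDegree.mp hh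
      refine Finset.mem_filter.mpr ⟨mem_monicsOfDegree.mpr ⟨hQ.mul ha, ?_⟩, dvd_mul_right _ _⟩
      rw [hQ.natDegree_mul ha, hQm, hb]; omega
    · intro a _ b _ hab
      exact mul_left_cancel₀ hQ.ne_zero hab
    · intro h hh
      obtain ⟨ha, g, rfl⟩ := Finset.mem_filter.mp hh
      obtain ⟨ha, hb⟩ := mem_monicsOfDegree.mp ha
      have hg : g.Monic := hQ.of_mul_monic_left ha
      refine ⟨g, mem_monicsOfDegree.mpr ⟨hg, ?_⟩, rfl⟩
      rw [hQ.natDegree_mul hg] at hb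
      omega
    · intro h hh
      exact (hmul _ _ hQ (mem_monicsOfDegree.mp hh).1).symm
  calc (n : ℂ) * ∑ h ∈ monicsOfDegree k n, Λ h
      = ∑ h ∈ monicsOfDegree k n, ∑ m ∈ Finset.Icc 1 n, ∑ r ∈ m.divisors,
          ∑ P ∈ irreduciblesOfDegree k r, (r : ℂ) * if P ^ (m / r) ∣ h then Λ h else 0 := by
        rw [Finset.mul_sum]
        refine Finset.sum_congr rfl fun h hh ↦ ?_
        obtain ⟨ha, hb⟩ := mem_monicsOfDegree.mp hh
        have := natDegree_eq_sum_prime_pow_dvd ha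
        rw [hb] at this
        conv_lhs => rw [this]
        push_cast
        simp_rw [Finset.sum_mul]
        refine Finset.sum_congr rfl fun m _ ↦ Finset.sum_congr rfl fun r _ ↦
          Finset.sum_congr rfl fun P _ ↦ ?_
        split_ifs <;> simp
    _ = ∑ m ∈ Finset.Icc 1 n, ∑ r ∈ m.divisors, ∑ P ∈ irreduciblesOfDegree k r,
          (r : ℂ) * (Λ P ^ (m / r) * ∑ h ∈ monicsOfDegree k (n - m), Λ h) := by
        rw [Finset.sum_comm]
        refine Finset.sum_congr rfl fun m hm ↦ ?_
        rw [Finset.sum_comm]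
        refine Finset.sum_congr rfl fun r hr ↦ ?_
        rw [Finset.sum_comm]
        refine Finset.sum_congr rfl fun P hP ↦ ?_
        obtain ⟨hPm, hPr, -⟩ := mem_irreduciblesOfDegree.mp hP
        rw [← Finset.mul_sum, hdiv _ m (hPm.pow _) _ (Finset.mem_Icc.mp hm).2, hpow _ _ hPm]
        rw [natDegree_pow, hPr, Nat.div_mul_cancel (Nat.dvd_of_mem_divisors hr)]
    _ = _ := by
        refine Finset.sum_bij' (fun m _ ↦ n - m) (fun i _ ↦ n - i) ?_ ?_ ?_ ?_ ?_
        · intro m hm; have := Finset.mem_Icc.mp hm; exact Finset.mem_range.mpr (by omega)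
        · intro m hm; have := Finset.mem_range.mp hm; exact Finset.mem_Icc.mpr (by omega)
        · intro m hm; have := Finset.mem_Icc.mp hm; omega
        · intro m hm; have := Finset.mem_range.mp hm; omega
        · intro m hm
          have := Finset.mem_Icc.mp hm
          rw [Nat.sub_sub_self this.2, Finset.mul_sum]
          refine Finset.sum_congr rfl fun r _ ↦ ?_
          rw [Finset.mul_sum]
          refine Finset.sum_congr rfl fun P _ ↦ ?_
          ring

open Polynomial in
/-- The sum of the values of `F` over the roots of a monic polynomial `h`, read off from the
remainder of `F * h'` modulo `h`. -/
noncomputable def sumAtRoots {R : Type*} [CommRing R] (F h : R[X]) : R :=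
  (F * derivative h %ₘ h).coeff (h.natDegree - 1)

namespace sumAtRoots

open Polynomial

variable {R : Type*} [CommRing R]

theorem eq_coeff_of_eq [Nontrivial R] {F h A B : R[X]} (hh : h.Monic)
    (h1 : F * derivative h = h * A + B) (h2 : B.degree < h.degree) :
    sumAtRoots F h = B.coeff (h.natDegree - 1) := by
  rw [sumAtRoots, (div_modByMonic_unique A B hh ⟨by rw [h1, add_comm], h2⟩).2]

theorem one (F : R[X]) : sumAtRoots F 1 = 0 := by simp [sumAtRoots]

theorem mul [Nontrivial R] (F : R[X]) {h₁ h₂ : R[X]} (m₁ : h₁.Monic) (m₂ : h₂.Monic) :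
    sumAtRoots F (h₁ * h₂) = sumAtRoots F h₁ + sumAtRoots F h₂ := by
  rcases Nat.eq_zero_or_pos h₁.natDegree with d₁ | d₁
  · rw [m₁.natDegree_eq_zero.mp d₁, one_mul, one, zero_add]
  rcases Nat.eq_zero_or_pos h₂.natDegree with d₂ | d₂
  · rw [m₂.natDegree_eq_zero.mp d₂, mul_one, one, add_zero]
  set A₁ := F * derivative h₁ /ₘ h₁
  set A₂ := F * derivative h₂ /ₘ h₂
  set B₁ := F * derivative h₁ %ₘ h₁ with hB₁
  set B₂ := F * derivative h₂ %ₘ h₂ with hB₂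
  have e₁ : B₁ + h₁ * A₁ = F * derivative h₁ := modByMonic_add_div _ _
  have e₂ : B₂ + h₂ * A₂ = F * derivative h₂ := modByMonic_add_div _ _
  have n₁ : B₁.natDegree < h₁.natDegree := natDegree_modByMonic_lt _ m₁ (by
    rintro rfl; simp at d₁)
  have n₂ : B₂.natDegree < h₂.natDegree := natDegree_modByMonic_lt _ m₂ (by
    rintro rfl; simp at d₂)
  have hdeg : (h₁ * h₂).natDegree = h₁.natDegree + h₂.natDegree := m₁.natDegree_mul m₂
  have key : F * derivative (h₁ * h₂) = h₁ * h₂ * (A₁ + A₂) + (B₁ * h₂ + h₁ * B₂) := by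
    rw [derivative_mul]
    linear_combination -h₂ * e₁ - h₁ * e₂
  rw [eq_coeff_of_eq (m₁.mul m₂) key]
  · have c₁ := coeff_mul_add_eq_of_natDegree_le (f := B₁) (g := h₂) (df := h₁.natDegree - 1)
      (dg := h₂.natDegree) (by omega) le_rfl
    have c₂ := coeff_mul_add_eq_of_natDegree_le (f := h₁) (g := B₂) (df := h₁.natDegree)
      (dg := h₂.natDegree - 1) le_rfl (by omega)
    rw [m₂.coeff_natDegree, mul_one] at c₁
    rw [m₁.coeff_natDegree, one_mul] at c₂
    rw [coeff_add, hdeg, sumAtRoots, sumAtRoots, ← hB₁, ← hB₂, ← c₁, ← c₂]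
    congr 2 <;> omega
  · apply degree_lt_degree
    rw [hdeg]
    refine (natDegree_add_le _ _).trans_lt (max_lt ?_ ?_)
    · exact natDegree_mul_le.trans_lt (by omega)
    · exact natDegree_mul_le.trans_lt (by omega)

theorem eq_of_natDegree_sub_lt [Nontrivial R] {F h₁ h₂ : R[X]} {n : ℕ} (m₁ : h₁.Monic)
    (m₂ : h₂.Monic) (d₁ : h₁.natDegree = n) (d₂ : h₂.natDegree = n)
    (h : h₂ = h₁ ∨ (h₂ - h₁).natDegree + F.natDegree < n) :
    sumAtRoots F h₁ = sumAtRoots F h₂ := by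
  rcases h with rfl | h
  · rfl
  set δ := h₂ - h₁ with hδ
  have e : h₂ = h₁ + δ := by rw [hδ]; ring
  set A := F * derivative h₁ /ₘ h₁ with hA
  set B := F * derivative h₁ %ₘ h₁ with hB
  have e₁ : B + h₁ * A = F * derivative h₁ := modByMonic_add_div _ _
  have hBd : B.natDegree < n := d₁ ▸ natDegree_modByMonic_lt _ m₁ (by
    rintro rfl; simp at d₁; omega)
  have key : F * derivative h₂ = h₂ * A + (B + (F * derivative δ - A * δ)) := by
    rw [e, derivative_add]
    linear_combination -e₁
  have hdh : (derivative h₁).natDegree ≤ n - 1 := d₁ ▸ natDegree_derivative_le h₁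
  have t₁ : F * derivative δ = 0 ∨ (F * derivative δ).natDegree < n - 1 := by
    rcases Nat.eq_zero_or_pos δ.natDegree with hz | hz
    · left
      rw [derivative_of_natDegree_zero hz, mul_zero]
    · right
      have := natDegree_derivative_le δ
      have := natDegree_mul_le (p := F) (q := derivative δ)
      omega
  have t₂ : A * δ = 0 ∨ (A * δ).natDegree < n - 1 := by
    rcases Nat.eq_zero_or_pos F.natDegree with hz | hz
    · left
      have : A = 0 := by
        rw [hA, divByMonic_eq_zero_iff m₁]
        apply degree_lt_degree
        have := natDegree_mul_le (p := F) (q := derivative h₁)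
        omega
      rw [this, zero_mul]
    · right
      have h1 : A.natDegree = (F * derivative h₁).natDegree - n := by
        rw [hA, natDegree_divByMonic _ m₁, d₁]
      have := natDegree_mul_le (p := F) (q := derivative h₁)
      have := natDegree_mul_le (p := A) (q := δ)
      omega
  have v₁ : (F * derivative δ).coeff (n - 1) = 0 := by
    rcases t₁ with t | t
    · rw [t, coeff_zero]
    · exact coeff_eq_zero_of_natDegree_lt t
  have v₂ : (A * δ).coeff (n - 1) = 0 := by
    rcases t₂ with t | t
    · rw [t, coeff_zero]
    · exact coeff_eq_zero_of_natDegree_lt t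
  rw [eq_coeff_of_eq m₂ key, sumAtRoots, ← hB, d₁, d₂, coeff_add, coeff_sub, v₁, v₂]
  · simp
  · apply degree_lt_degree
    rw [d₂]
    refine (natDegree_add_le _ _).trans_lt (max_lt hBd ?_)
    refine (natDegree_sub_le _ _).trans_lt (max_lt ?_ ?_)
    · rcases t₁ with t | t
      · rw [t, natDegree_zero]; omega
      · omega
    · rcases t₂ with t | t
      · rw [t, natDegree_zero]; omega
      · omega

theorem map {S : Type*} [CommRing S] [Nontrivial S] (φ : R →+* S) (F : R[X]) {h : R[X]}
    (hh : h.Monic) :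
    sumAtRoots (F.map φ) (h.map φ) = φ (sumAtRoots F h) := by
  rw [sumAtRoots, sumAtRoots, hh.natDegree_map, derivative_map, ← Polynomial.map_mul,
    ← map_modByMonic _ hh, coeff_map]

theorem eq_sum_roots {K : Type*} [Field K] (F : K[X]) {h : K[X]} (hm : h.Monic) (hs : h.Splits) :
    sumAtRoots F h = (h.roots.map fun a ↦ F.eval a).sum := by
  have key : ∀ s : Multiset K, sumAtRoots F ((s.map fun a ↦ X - C a).prod) =
      (s.map fun a ↦ F.eval a).sum := by
    intro s
    induction s using Multiset.induction_on with
    | empty => simp [one]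
    | cons a s ih =>
      rw [Multiset.map_cons, Multiset.prod_cons, mul F (monic_X_sub_C a)
        (monic_multisetProd_X_sub_C s), ih, Multiset.map_cons, Multiset.sum_cons]
      simp [sumAtRoots, modByMonic_X_sub_C_eq_C_eval]
  conv_lhs => rw [hs.eq_prod_roots_of_monic hm]
  exact key _

end sumAtRoots

open Polynomial in
/-- The resultant of `G` and `f`; for monic `G` it is the product of the values of `f` at the roots
of `G`. -/
noncomputable def prodAtRoots {R : Type*} [CommRing R] (G f : R[X]) : R :=
  resultant G f

namespace prodAtRoots

open Polynomial

variable {k : Type*} [Field k]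

theorem algebraMap_eq (Ω : Type*) [Field Ω] [IsAlgClosed Ω] [Algebra k Ω] {G : k[X]}
    (hG : G.Monic) (f : k[X]) :
    algebraMap k Ω (prodAtRoots G f) = ((G.aroots Ω).map fun b ↦ aeval b f).prod := by
  have h := resultant_map_map G f G.natDegree f.natDegree (algebraMap k Ω)
  rw [prodAtRoots, ← h]
  have h2 := resultant_eq_prod_eval (G.map (algebraMap k Ω)) (f.map (algebraMap k Ω))
    f.natDegree (natDegree_map_le) (IsAlgClosed.splits _)
  rw [natDegree_map, (hG.map _).leadingCoeff, one_pow, one_mul] at h2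
  rw [h2, aroots_def]
  congr 1
  refine Multiset.map_congr rfl fun b _ ↦ ?_
  rw [eval_map_algebraMap]

theorem mul {G : k[X]} (hG : G.Monic) (f g : k[X]) :
    prodAtRoots G (f * g) = prodAtRoots G f * prodAtRoots G g := by
  apply (algebraMap k (AlgebraicClosure k)).injective
  rw [map_mul, algebraMap_eq _ hG, algebraMap_eq _ hG, algebraMap_eq _ hG, ← Multiset.prod_map_mul]
  simp

theorem one {G : k[X]} (hG : G.Monic) : prodAtRoots G 1 = 1 := by
  apply (algebraMap k (AlgebraicClosure k)).injective
  rw [algebraMap_eq _ hG]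
  simp

theorem congr {G : k[X]} (hG : G.Monic) {f g : k[X]}
    (h : ∀ b : AlgebraicClosure k, aeval b G = 0 → aeval b f = aeval b g) :
    prodAtRoots G f = prodAtRoots G g := by
  apply (algebraMap k (AlgebraicClosure k)).injective
  rw [algebraMap_eq _ hG, algebraMap_eq _ hG]
  congr 1
  exact Multiset.map_congr rfl fun b hb ↦ h b (mem_aroots.mp hb).2

end prodAtRoots

open Polynomial in
/-- The completely multiplicative function whose `L`-series encodes the character sums
`∑ ψ (F x) χ (u G x)`. -/
noncomputable def twistedChar {k : Type*} [Field k] (ψ : AddChar k ℂ) (χ : MulChar k ℂ)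
    (F G : k[X]) (u : k) (h : k[X]) : ℂ :=
  ψ (sumAtRoots F h) * χ (u ^ h.natDegree * prodAtRoots G h)

open Polynomial in
theorem twistedChar_mul {k : Type*} [Field k] (ψ : AddChar k ℂ) (χ : MulChar k ℂ)
    {F G : k[X]} (hG : G.Monic) (u : k) (f g : k[X]) (hf : f.Monic) (hg : g.Monic) :
    twistedChar ψ χ F G u (f * g) = twistedChar ψ χ F G u f * twistedChar ψ χ F G u g := by
  simp only [twistedChar, sumAtRoots.mul F hf hg, prodAtRoots.mul hG, hf.natDegree_mul hg, pow_add,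
    AddChar.map_add_eq_mul, map_mul]
  ring

open Polynomial in
theorem twistedChar_one {k : Type*} [Field k] (ψ : AddChar k ℂ) (χ : MulChar k ℂ)
    {F G : k[X]} (hG : G.Monic) (u : k) : twistedChar ψ χ F G u 1 = 1 := by
  simp [twistedChar, sumAtRoots.one, prodAtRoots.one hG]

open Polynomial in
/-- The coefficients of the `L`-series of `twistedChar` vanish from degree `deg F + deg r` on,
where `r` has the same roots as `G`. -/
theorem sum_twistedChar_eq_zero {k : Type*} [Field k] [Finite k] (ψ : AddChar k ℂ)
    (χ : MulChar k ℂ) {F G r r₀ : k[X]} (hG : G.Monic) (u : k) (hr : r.Monic)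
    (hroots : ∀ b : AlgebraicClosure k, aeval b G = 0 → aeval b r = 0) (hr₀ : IsCoprime r r₀)
    (hχ : χ (prodAtRoots G r₀) ≠ 1) {n : ℕ} (hn : F.natDegree + r.natDegree ≤ n) :
    ∑ h ∈ monicsOfDegree k n, twistedChar ψ χ F G u h = 0 := by
  set φ : k[X] → k[X] := fun h ↦ h - h %ₘ r + (r₀ * h) %ₘ r with hφ
  have hsub : ∀ h, φ h = h ∨ (φ h - h).natDegree < r.natDegree := by
    intro h
    by_cases h1 : r = 1
    · left; simp [hφ, h1]
    · right
      have : φ h - h = (r₀ * h) %ₘ r - h %ₘ r := by rw [hφ]; ring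
      rw [this]
      exact (natDegree_sub_le _ _).trans_lt (max_lt (natDegree_modByMonic_lt _ hr h1)
        (natDegree_modByMonic_lt _ hr h1))
  have hdvd : ∀ h, r ∣ φ h - r₀ * h := by
    intro h
    have e1 := modByMonic_add_div h r
    have e2 := modByMonic_add_div (r₀ * h) r
    refine ⟨h /ₘ r - (r₀ * h) /ₘ r, ?_⟩
    simp only [hφ]
    linear_combination e2 - e1
  have hmem : ∀ h ∈ monicsOfDegree k n, φ h ∈ monicsOfDegree k n := by
    intro h hh
    rcases hsub h with e | hlt
    · rwa [e]
    · obtain ⟨hm, hd⟩ := mem_monicsOfDegree.mp hh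
      have e : φ h = h + (φ h - h) := by ring
      have hlt' : (φ h - h).degree < h.degree := degree_lt_degree (by omega)
      refine mem_monicsOfDegree.mpr ⟨?_, ?_⟩
      · rw [e]; exact hm.add_of_left hlt'
      · rw [e, natDegree_add_eq_left_of_degree_lt hlt', hd]
  have hinj : Set.InjOn φ (monicsOfDegree k n) := by
    intro a _ b _ hab
    have h1 : r ∣ r₀ * (a - b) := by
      have := dvd_sub (hdvd b) (hdvd a)
      rw [hab] at this
      convert this using 1; ring
    have h2 : r ∣ a - b := hr₀.dvd_of_dvd_mul_left h1
    have h3 : a %ₘ r = b %ₘ r := by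
      rw [← sub_eq_zero, ← sub_modByMonic, (modByMonic_eq_zero_iff_dvd hr).mpr h2]
    have h4 : (r₀ * a) %ₘ r = (r₀ * b) %ₘ r := by
      rw [← sub_eq_zero, ← sub_modByMonic, ← mul_sub, (modByMonic_eq_zero_iff_dvd hr).mpr h1]
    simp only [hφ, h3, h4] at hab
    simpa using hab
  have hsurj : Set.SurjOn φ (monicsOfDegree k n) (monicsOfDegree k n) :=
    Finset.surjOn_of_injOn_of_card_le φ hmem hinj le_rfl
  have hval : ∀ h ∈ monicsOfDegree k n,
      twistedChar ψ χ F G u (φ h) = χ (prodAtRoots G r₀) * twistedChar ψ χ F G u h := by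
    intro h hh
    obtain ⟨hm, hd⟩ := mem_monicsOfDegree.mp hh
    obtain ⟨hm', hd'⟩ := mem_monicsOfDegree.mp (hmem h hh)
    have h1 : sumAtRoots F (φ h) = sumAtRoots F h := by
      refine (sumAtRoots.eq_of_natDegree_sub_lt hm hm' hd hd' ((hsub h).imp id fun h ↦ ?_)).symm
      omega
    have h2 : prodAtRoots G (φ h) = prodAtRoots G r₀ * prodAtRoots G h := by
      rw [← prodAtRoots.mul hG]
      refine prodAtRoots.congr hG fun b hb ↦ ?_
      obtain ⟨g, hg⟩ := hdvd h
      have := congrArg (aeval b) hg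
      rw [map_sub, map_mul (aeval b) r, hroots b hb, zero_mul, sub_eq_zero] at this
      exact this
    rw [twistedChar, twistedChar, h1, h2, hd, hd']
    simp only [map_mul]
    ring
  have hsum : ∑ h ∈ monicsOfDegree k n, twistedChar ψ χ F G u (φ h) =
      ∑ h ∈ monicsOfDegree k n, twistedChar ψ χ F G u h :=
    Finset.sum_nbij φ hmem hinj hsurj fun _ _ ↦ rfl
  rw [Finset.sum_congr rfl hval, ← Finset.mul_sum] at hsum
  have : (χ (prodAtRoots G r₀) - 1) * ∑ h ∈ monicsOfDegree k n, twistedChar ψ χ F G u h = 0 := by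
    rw [sub_mul, one_mul, hsum, sub_self]
  exact (mul_eq_zero.mp this).resolve_left (sub_ne_zero.mpr hχ)

section AtMinpoly

open Polynomial IntermediateField Module

variable {k L : Type*} [Field k] [Field L] [Algebra k L] [FiniteDimensional k L]
  [Algebra.IsSeparable k L]

theorem prod_algHom_adjoin_eq_prod_aroots {M : Type*} [CommMonoid M] (x : L)
    (g : AlgebraicClosure k → M) :
    ∏ σ : k⟮x⟯ →ₐ[k] AlgebraicClosure k, g (σ (AdjoinSimple.gen k x)) =
      (((minpoly k x).aroots (AlgebraicClosure k)).map g).prod := by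
  classical
  have hx := Algebra.IsSeparable.isIntegral k x
  have hsep := Algebra.IsSeparable.isSeparable k x
  have hnd : ((minpoly k x).aroots (AlgebraicClosure k)).Nodup := nodup_aroots_iff_of_splits
    (minpoly.ne_zero hx) (IsAlgClosed.splits _) |>.mpr hsep
  rw [Fintype.prod_equiv (algHomAdjoinIntegralEquiv k (K := AlgebraicClosure k) hx)
    (fun σ ↦ g (σ (AdjoinSimple.gen k x))) (fun b ↦ g b.1) (fun σ ↦ by rfl)]
  rw [Finset.prod_mem_multiset _ _ g (fun _ ↦ rfl), Finset.prod, Multiset.toFinset_val,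
    hnd.dedup]

theorem norm_aeval_eq_prodAtRoots (x : L) (f : k[X]) :
    Algebra.norm k (aeval x f) = prodAtRoots (minpoly k x) f ^ finrank k⟮x⟯ L := by
  have hx := Algebra.IsSeparable.isIntegral k x
  have e : aeval x f = algebraMap k⟮x⟯ L (aeval (AdjoinSimple.gen k x) f) := by
    rw [← aeval_algebraMap_apply, AdjoinSimple.algebraMap_gen]
  have : Algebra.IsSeparable k k⟮x⟯ := Algebra.isSeparable_tower_bot_of_isSeparable k k⟮x⟯ L
  rw [e, ← Algebra.norm_norm (S := k⟮x⟯), Algebra.norm_algebraMap, map_pow]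
  congr 1
  apply (algebraMap k (AlgebraicClosure k)).injective
  rw [prodAtRoots.algebraMap_eq _ (minpoly.monic hx), Algebra.norm_eq_prod_embeddings,
    ← prod_algHom_adjoin_eq_prod_aroots]
  simp only [aeval_algHom_apply]

theorem trace_aeval_eq_sumAtRoots (x : L) (f : k[X]) :
    Algebra.trace k L (aeval x f) = finrank k⟮x⟯ L • sumAtRoots f (minpoly k x) := by
  have hx := Algebra.IsSeparable.isIntegral k x
  have e : aeval x f = algebraMap k⟮x⟯ L (aeval (AdjoinSimple.gen k x) f) := by
    rw [← aeval_algebraMap_apply, AdjoinSimple.algebraMap_gen]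
  have : Algebra.IsSeparable k k⟮x⟯ := Algebra.isSeparable_tower_bot_of_isSeparable k k⟮x⟯ L
  rw [e, ← Algebra.trace_trace (S := k⟮x⟯), Algebra.trace_algebraMap, map_nsmul]
  congr 1
  apply (algebraMap k (AlgebraicClosure k)).injective
  rw [← sumAtRoots.map _ _ (minpoly.monic hx), sumAtRoots.eq_sum_roots _
    ((minpoly.monic hx).map _) (IsAlgClosed.splits _), trace_eq_sum_embeddings]
  have := prod_algHom_adjoin_eq_prod_aroots (M := Multiplicative (AlgebraicClosure k)) x
    (fun b ↦ Multiplicative.ofAdd (aeval b f))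
  simp only [aeval_algHom_apply, eval_map_algebraMap] at this ⊢
  exact this

end AtMinpoly

open Polynomial in
theorem prodAtRoots_eq_norm_adjoinRoot {k : Type*} [Field k] [PerfectField k] {P : k[X]}
    (hm : P.Monic) [Fact (Irreducible P)] (f : k[X]) :
    prodAtRoots P f = Algebra.norm k (AdjoinRoot.mk P f) := by
  have : FiniteDimensional k (AdjoinRoot P) := (AdjoinRoot.powerBasis hm.ne_zero).finite
  have h := norm_aeval_eq_prodAtRoots (k := k) (AdjoinRoot.root P) f
  have htop : IntermediateField.adjoin k {AdjoinRoot.root P} = ⊤ := by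
    have h1 := IntermediateField.adjoin.finrank
      (Algebra.IsSeparable.isIntegral k (AdjoinRoot.root P))
    refine IntermediateField.eq_of_le_of_finrank_eq le_top ?_
    rw [IntermediateField.finrank_top', h1, AdjoinRoot.minpoly_root hm.ne_zero, (AdjoinRoot.powerBasis hm.ne_zero).finrank]
    simp [hm.leadingCoeff]
  rw [AdjoinRoot.aeval_eq, htop, IntermediateField.finrank_top, pow_one,
    AdjoinRoot.minpoly_root hm.ne_zero, hm.leadingCoeff] at h
  simpa using h.symm

section Multiplicity

open Polynomial UniqueFactorizationMonoid

variable {k : Type*} [Field k]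

theorem exists_eq_C_mul_pow_of_dvd_multiplicity {G : k[X]} (hG : G ≠ 0) {l : ℕ}
    (h : ∀ (P G' : k[X]) (m : ℕ), Irreducible P → G = P ^ m * G' → ¬ P ∣ G' → l ∣ m) :
    ∃ (c : k) (H : k[X]), c ≠ 0 ∧ G = C c * H ^ l := by
  classical
  obtain ⟨T, hT⟩ := Multiset.exists_smul_of_dvd_count (normalizedFactors G) (k := l) (by
    intro P hP
    have hirr := irreducible_of_normalized_factor P hP
    obtain ⟨G', h1, h2⟩ :=
      (FiniteMultiplicity.of_prime_left hirr.prime hG).exists_eq_pow_mul_and_not_dvd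
    have h3 := h P G' _ hirr h1 h2
    have h4 := emultiplicity_eq_count_normalizedFactors hirr hG
    rw [(FiniteMultiplicity.of_prime_left hirr.prime hG).emultiplicity_eq_multiplicity,
      normalize_normalized_factor P hP] at h4
    rwa [← Nat.cast_inj.mp h4])
  have h1 := prod_normalizedFactors hG
  rw [hT, Multiset.prod_nsmul] at h1
  obtain ⟨u, hu⟩ := h1
  obtain ⟨c, hc, hc'⟩ := isUnit_iff.mp u.isUnit
  exact ⟨c, T.prod, hc.ne_zero, by rw [← hu, ← hc', mul_comm]⟩

theorem exists_monic_irreducible_not_dvd {G : k[X]} (hG : G ≠ 0) {l : ℕ}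
    (h : ¬ ∃ (c : k) (H : k[X]), c ≠ 0 ∧ G = C c * H ^ l) :
    ∃ (P G' : k[X]) (m : ℕ), P.Monic ∧ Irreducible P ∧ G = P ^ m * G' ∧ ¬ P ∣ G' ∧ ¬ l ∣ m := by
  by_contra! hcon
  refine h (exists_eq_C_mul_pow_of_dvd_multiplicity hG fun P G' m hP hPG hPG' ↦ ?_)
  have ha : P.leadingCoeff ≠ 0 := leadingCoeff_ne_zero.mpr hP.ne_zero
  have hu : IsUnit (C P.leadingCoeff⁻¹ : k[X]) := isUnit_C.mpr (by simpa using hP.ne_zero)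
  have hu' : IsUnit (C (P.leadingCoeff ^ m) : k[X]) := isUnit_C.mpr (by
    simpa using fun h ↦ absurd h hP.ne_zero)
  refine hcon (P * C P.leadingCoeff⁻¹) (C (P.leadingCoeff ^ m) * G') m
    (monic_mul_leadingCoeff_inv hP.ne_zero) ((irreducible_mul_isUnit hu).mpr hP) ?_ ?_
  · rw [mul_pow, hPG]
    have : (C P.leadingCoeff⁻¹ : k[X]) ^ m * C (P.leadingCoeff ^ m) = 1 := by
      rw [C_pow, ← mul_pow, ← C_mul, inv_mul_cancel₀ ha, C_1, one_pow]
    linear_combination -P ^ m * G' * this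
  · rwa [hu.mul_right_dvd, hu'.dvd_mul_left]

theorem exists_monic_natDegree_eq_ncard_roots [PerfectField k] {G : k[X]} (hG : G ≠ 0) :
    ∃ r : k[X], r.Monic ∧ r ∣ G ∧ (∀ b : AlgebraicClosure k, aeval b G = 0 → aeval b r = 0) ∧
      r.natDegree = {x : AlgebraicClosure k | aeval x G = 0}.ncard := by
  classical
  have h0 : radical G ≠ 0 := radical_ne_zero
  have hassoc : Associated (normalize (radical G)) (radical G) := normalize_associated _
  have hdvd : normalize (radical G) ∣ G := hassoc.dvd.trans radical_dvd_self
  have hroots : ∀ b : AlgebraicClosure k,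
      aeval b G = 0 → aeval b (normalize (radical G)) = 0 := by
    intro b hb
    obtain ⟨n, hn⟩ := exists_dvd_radical_self_pow hG
    have h1 := aeval_eq_zero_of_dvd_aeval_eq_zero hn hb
    rw [map_pow] at h1
    exact aeval_eq_zero_of_dvd_aeval_eq_zero hassoc.symm.dvd (by
      by_contra h2; exact pow_ne_zero n h2 h1)
  refine ⟨normalize (radical G), monic_normalize h0, hdvd, hroots, ?_⟩
  have hsep : (normalize (radical G)).Separable := by
    rw [PerfectField.separable_iff_squarefree]
    exact squarefree_radical.squarefree_of_dvd hassoc.dvd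
  rw [← card_rootSet_eq_natDegree (K := AlgebraicClosure k) hsep (IsAlgClosed.splits _),
    ← Nat.card_eq_fintype_card, Nat.card_coe_set_eq]
  congr 1
  ext b
  rw [mem_rootSet_of_ne (monic_normalize h0).ne_zero]
  exact ⟨fun h ↦ aeval_eq_zero_of_dvd_aeval_eq_zero hdvd h, fun h ↦ hroots b h⟩

end Multiplicity

open Polynomial in
theorem exists_isCoprime_mulChar_prodAtRoots_ne_one {k : Type*} [Field k] [Finite k]
    (χ : MulChar k ℂ) {P G' : k[X]} {m : ℕ} (hP : P.Monic) (hirr : Irreducible P)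
    (hG' : (P ^ m * G').Monic) (hPG' : ¬ P ∣ G') (hχ : χ ^ m ≠ 1) :
    ∃ r₀, IsCoprime (P ^ m * G') r₀ ∧ χ (prodAtRoots (P ^ m * G') r₀) ≠ 1 := by
  have : Fact (Irreducible P) := ⟨hirr⟩
  obtain ⟨t, ht⟩ : ∃ t : kˣ, (χ ^ m) t ≠ 1 := by
    by_contra! h
    exact hχ (MulChar.ext fun t ↦ by rw [h, MulChar.one_apply_coe])
  have : FiniteDimensional k (AdjoinRoot P) := (AdjoinRoot.powerBasis hP.ne_zero).finite
  have : Finite (AdjoinRoot P) := Module.finite_of_finite k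
  obtain ⟨y, hy⟩ := FiniteField.norm_surjective k (AdjoinRoot P) t
  obtain ⟨γ, rfl⟩ := AdjoinRoot.mk_surjective y
  have hcop : IsCoprime P G' := hirr.coprime_iff_not_dvd.mpr hPG'
  obtain ⟨a, b, hab⟩ := hcop
  have hG'm : G'.Monic := (hP.pow m).of_mul_monic_left hG'
  have hPt : prodAtRoots P γ = t := by rw [prodAtRoots_eq_norm_adjoinRoot hP, hy]
  have hval : prodAtRoots (P ^ m * G') (a * P + γ * (b * G')) = (t : k) ^ m := by
    apply (algebraMap k (AlgebraicClosure k)).injective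
    rw [prodAtRoots.algebraMap_eq _ hG', aroots_mul hG'.ne_zero, aroots_pow, Multiset.map_add,
      Multiset.prod_add, Multiset.map_nsmul, Multiset.prod_nsmul, map_pow, ← hPt,
      prodAtRoots.algebraMap_eq _ hP]
    have h1 : ((G'.aroots (AlgebraicClosure k)).map
        fun x ↦ aeval x (a * P + γ * (b * G'))).prod = 1 := by
      refine Multiset.prod_eq_one fun z hz ↦ ?_
      obtain ⟨x, hx, rfl⟩ := Multiset.mem_map.mp hz
      have hx0 := (mem_aroots.mp hx).2
      have := congrArg (aeval x) hab
      simp only [map_add, map_mul, hx0, mul_zero, add_zero, map_one] at this ⊢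
      exact this
    rw [h1, mul_one]
    congr 2
    refine Multiset.map_congr rfl fun x hx ↦ ?_
    have hx0 := (mem_aroots.mp hx).2
    have := congrArg (aeval x) hab
    simp only [map_add, map_mul, hx0, mul_zero, zero_add, map_one] at this ⊢
    rw [this, mul_one]
  refine ⟨a * P + γ * (b * G'), ?_, ?_⟩
  · have hγ : IsCoprime P γ := by
      refine hirr.coprime_iff_not_dvd.mpr fun h ↦ ?_
      rw [AdjoinRoot.mk_eq_zero.mpr h, Algebra.norm_zero] at hy
      exact t.ne_zero hy.symm
    have hPb : IsCoprime P (b * G') := ⟨a, 1, by linear_combination hab⟩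
    refine IsCoprime.mul_left (IsCoprime.pow_left ?_) ?_
    · obtain ⟨c, d, hcd⟩ := hγ.mul_right hPb
      exact ⟨c - d * a, d, by linear_combination hcd⟩
    · exact ⟨b - γ * b, 1, by linear_combination hab⟩
  · rw [hval]
    rwa [map_pow, ← MulChar.pow_apply_coe]

section PointCount

open Polynomial Module

variable {k L : Type*} [Field k] [Finite k] [Field L] [Finite L] [Algebra k L]

theorem twistedChar_minpoly_pow (ψ : AddChar k ℂ) (χ : MulChar k ℂ) (F G : k[X])
    (c : k) (x : L) :
    twistedChar ψ χ F G (c * (-1) ^ G.natDegree) (minpoly k x) ^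
        (finrank k L / (minpoly k x).natDegree) =
      ψ (Algebra.trace k L (aeval x F)) * χ (Algebra.norm k (aeval x (C c * G))) := by
  have hx : IsIntegral k x := Algebra.IsIntegral.isIntegral x
  have hdeg := IntermediateField.adjoin.finrank hx
  have hpos : 0 < (minpoly k x).natDegree := minpoly.natDegree_pos hx
  have htower := finrank_mul_finrank k (IntermediateField.adjoin k {x}) L
  have he : finrank k L / (minpoly k x).natDegree = finrank (IntermediateField.adjoin k {x}) L := by
    rw [← htower, hdeg, Nat.mul_div_cancel_left _ hpos]
  have hprod : prodAtRoots (minpoly k x) (C c * G) =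
      (c * (-1) ^ G.natDegree) ^ (minpoly k x).natDegree * prodAtRoots G (minpoly k x) := by
    rw [prodAtRoots.mul (minpoly.monic hx)]
    have h1 : prodAtRoots (minpoly k x) (C c) = c ^ (minpoly k x).natDegree := by
      simp [prodAtRoots]
    have h2 : prodAtRoots (minpoly k x) G =
        (-1) ^ (G.natDegree * (minpoly k x).natDegree) * prodAtRoots G (minpoly k x) := by
      rw [prodAtRoots, resultant_comm, mul_comm (natDegree _)]
      rfl
    rw [h1, h2, mul_pow, pow_mul]
    ring
  rw [norm_aeval_eq_prodAtRoots, trace_aeval_eq_sumAtRoots, he, hprod, map_pow, AddChar.map_nsmul_eq_pow,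
    ← mul_pow]
  rfl

theorem card_filter_minpoly_eq [Fintype L] [DecidableEq k[X]] {P : k[X]} (hm : P.Monic)
    (hP : Irreducible P) (hd : P.natDegree ∣ finrank k L) :
    (Finset.univ.filter fun x : L ↦ minpoly k x = P).card = P.natDegree := by
  classical
  have hdvd := hP.natDegree_dvd_iff_dvd_X_pow_card_pow_sub_X.mp hd
  have hcard : Nat.card k ^ finrank k L = Nat.card L := (Module.natCard_eq_pow_finrank).symm
  have hs : (P.map (algebraMap k L)).Splits := by
    have h1 := Polynomial.map_dvd (algebraMap k L) hdvd
    rw [hcard] at h1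
    simp only [Polynomial.map_sub, Polynomial.map_pow, map_X] at h1
    refine Splits.of_dvd ?_ ?_ h1
    · exact Polynomial.splits_X_pow_nat_card_sub_X
    · exact FiniteField.X_pow_card_sub_X_ne_zero L Finite.one_lt_card
  rw [← card_rootSet_eq_natDegree (K := L) (PerfectField.separable_of_irreducible hP) hs,
    ← Set.toFinset_card]
  congr 1
  ext x
  rw [Finset.mem_filter, Set.mem_toFinset, mem_rootSet_of_ne hm.ne_zero]
  constructor
  · rintro ⟨-, rfl⟩
    exact minpoly.aeval k x
  · intro h
    exact ⟨Finset.mem_univ _, (minpoly.eq_of_irreducible_of_monic hP h hm).symm⟩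

theorem sum_irreduciblesOfDegree_eq_sum [Fintype L] (Λ : k[X] → ℂ) :
    ∑ r ∈ (finrank k L).divisors, ∑ P ∈ irreduciblesOfDegree k r,
        (r : ℂ) * Λ P ^ (finrank k L / r) =
      ∑ x : L, Λ (minpoly k x) ^ (finrank k L / (minpoly k x).natDegree) := by
  classical
  have hpos : 0 < finrank k L := finrank_pos
  have hintegral : ∀ x : L, IsIntegral k x := fun x ↦ Algebra.IsIntegral.isIntegral x
  rw [Finset.sum_sigma']
  rw [← Finset.sum_fiberwise_of_maps_to (s := Finset.univ) (t := (finrank k L).divisors.sigma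
    fun r ↦ irreduciblesOfDegree k r) (g := fun x : L ↦ ⟨(minpoly k x).natDegree, minpoly k x⟩)
    (fun x _ ↦ by
      rw [Finset.mem_sigma, Nat.mem_divisors]
      refine ⟨⟨?_, hpos.ne'⟩, mem_irreduciblesOfDegree.mpr ⟨minpoly.monic (hintegral x), rfl,
        minpoly.irreducible (hintegral x)⟩⟩
      exact minpoly.degree_dvd (hintegral x))]
  refine Finset.sum_congr rfl ?_
  rintro ⟨r, P⟩ h
  rw [Finset.mem_sigma, Nat.mem_divisors] at h
  dsimp only at h ⊢
  obtain ⟨⟨hr, -⟩, hP⟩ := h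
  obtain ⟨hm, rfl, hi⟩ := mem_irreduciblesOfDegree.mp hP
  have hf : (Finset.univ.filter fun x : L ↦
      (⟨(minpoly k x).natDegree, minpoly k x⟩ : Σ _ : ℕ, k[X]) = ⟨P.natDegree, P⟩) =
      Finset.univ.filter fun x : L ↦ minpoly k x = P := by
    ext x
    simp only [Finset.mem_filter, Finset.mem_univ, true_and]
    constructor
    · intro h
      exact eq_of_heq (Sigma.mk.inj h).2
    · intro h
      rw [h]
  rw [hf, Finset.sum_congr rfl (g := fun _ ↦ Λ P ^ (finrank k L / P.natDegree))]
  · rw [Finset.sum_const, card_filter_minpoly_eq hm hi hr, nsmul_eq_mul]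
  · intro x hx
    rw [(Finset.mem_filter.mp hx).2]

end PointCount

open Polynomial Module in
/-- Bounds of the right order for the character sums over all large fields of even degree imply the
Weil bound over the prime field. -/
theorem norm_sum_addChar_mul_mulChar_le {p : ℕ} [Fact p.Prime] (ψ : AddChar (ZMod p) ℂ)
    (χ : MulChar (ZMod p) ℂ) {F G : (ZMod p)[X]} (hG0 : G ≠ 0)
    (hG : ¬ ∃ (c : ZMod p) (H : (ZMod p)[X]), c ≠ 0 ∧ G = C c * H ^ orderOf χ)
    (C₀ : ℝ) (m₀ : ℕ)
    (hbound : ∀ m ≥ m₀, ∀ (L : Type) [Field L] [Fintype L] [Algebra (ZMod p) L],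
      finrank (ZMod p) L = 2 * m →
      ‖∑ x : L, ψ (Algebra.trace (ZMod p) L (aeval x F)) *
        χ (Algebra.norm (ZMod p) (aeval x G))‖ ≤ C₀ * p ^ m) :
    ‖∑ u : ZMod p, ψ (F.eval u) * χ (G.eval u)‖ ≤
      ((F.natDegree : ℝ) +
        ({x : AlgebraicClosure (ZMod p) | aeval x G = 0}.ncard : ℝ) - 1) * √p := by
  have hp : 0 < (p : ℝ) := by exact_mod_cast (Fact.out : p.Prime).pos
  set c := G.leadingCoeff with hc
  have hc0 : c ≠ 0 := leadingCoeff_ne_zero.mpr hG0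
  set G₁ := G * C c⁻¹ with hG₁
  have hm₁ : G₁.Monic := monic_mul_leadingCoeff_inv hG0
  have hCC : C c * C c⁻¹ = (1 : (ZMod p)[X]) := by rw [← C_mul, mul_inv_cancel₀ hc0, C_1]
  have hGG₁ : G = C c * G₁ := by
    rw [hG₁]; linear_combination -G * hCC
  have hG₁pow : ¬ ∃ (c : ZMod p) (H : (ZMod p)[X]), c ≠ 0 ∧ G₁ = C c * H ^ orderOf χ := by
    rintro ⟨a, H, ha, hH⟩
    exact hG ⟨c * a, H, mul_ne_zero hc0 ha, by rw [C_mul, mul_assoc, ← hH, ← hGG₁]⟩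
  obtain ⟨P, G', m, hPm, hPi, hPG, hPG', hm⟩ := exists_monic_irreducible_not_dvd hm₁.ne_zero hG₁pow
  have hχm : χ ^ m ≠ 1 := fun h ↦ hm (orderOf_dvd_of_pow_eq_one h)
  obtain ⟨r₀, hr₀, hχr₀⟩ := exists_isCoprime_mulChar_prodAtRoots_ne_one χ hPm hPi
    (hPG ▸ hm₁) hPG' hχm
  rw [← hPG] at hr₀ hχr₀
  obtain ⟨r, hrm, hrd, hroots, hdeg⟩ := exists_monic_natDegree_eq_ncard_roots hG0
  have hrd₁ : r ∣ G₁ := by rw [hG₁]; exact hrd.mul_right _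
  have hroots₁ : ∀ b : AlgebraicClosure (ZMod p), aeval b G₁ = 0 → aeval b r = 0 := by
    intro b hb
    exact hroots b (by rw [hGG₁, map_mul, hb, mul_zero])
  have hm0 : m ≠ 0 := by rintro rfl; simp at hm
  have hr1 : 1 ≤ r.natDegree := by
    rw [Nat.one_le_iff_ne_zero]
    intro h0
    rw [hrm.natDegree_eq_zero] at h0
    obtain ⟨b, hb⟩ := IsAlgClosed.exists_aeval_eq_zero (AlgebraicClosure (ZMod p)) P
      hPi.degree_pos.ne'
    have := hroots₁ b (by rw [hPG, map_mul, map_pow, hb, zero_pow hm0, zero_mul])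
    rw [h0, map_one] at this
    exact one_ne_zero this
  set u := c * (-1) ^ G₁.natDegree with hu
  set Λ := twistedChar ψ χ F G₁ u with hΛ
  set S : ℕ → ℂ := fun n ↦ ∑ r ∈ n.divisors, ∑ P ∈ irreduciblesOfDegree (ZMod p) r,
    (r : ℂ) * Λ P ^ (n / r) with hS
  set a : ℕ → ℂ := fun n ↦ ∑ h ∈ monicsOfDegree (ZMod p) n, Λ h with ha
  have hΛ1 : Λ 1 = 1 := twistedChar_one ψ χ hm₁ u
  have hSL : ∀ (L : Type) [Field L] [Fintype L] [Algebra (ZMod p) L],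
      S (finrank (ZMod p) L) = ∑ x : L, ψ (Algebra.trace (ZMod p) L (aeval x F)) *
        χ (Algebra.norm (ZMod p) (aeval x G)) := by
    intro L _ _ _
    rw [hS]
    dsimp only
    rw [sum_irreduciblesOfDegree_eq_sum Λ]
    refine Finset.sum_congr rfl fun x _ ↦ ?_
    rw [hΛ, hu, twistedChar_minpoly_pow, ← hGG₁]
  have ha0 : a 0 = 1 := by
    have : monicsOfDegree (ZMod p) 0 = {1} := by
      ext h
      rw [mem_monicsOfDegree, Finset.mem_singleton]
      constructor
      · rintro ⟨h1, h2⟩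
        exact h1.natDegree_eq_zero.mp h2
      · rintro rfl
        exact ⟨monic_one, natDegree_one⟩
    simp only [ha, this, Finset.sum_singleton, hΛ1]
  have haD : ∀ n, F.natDegree + r.natDegree - 1 < n → a n = 0 := fun n hn ↦
    sum_twistedChar_eq_zero ψ χ hm₁ u hrm hroots₁ (hr₀.of_isCoprime_of_dvd_left hrd₁) hχr₀
      (by omega)
  obtain ⟨W, hW, hWS⟩ := exists_powerSum_of_recurrence a S (F.natDegree + r.natDegree - 1) ha0 haD
    (fun n ↦ natCast_mul_sum_monicsOfDegree Λ (fun f g hf hg ↦ twistedChar_mul ψ χ hm₁ u f g hf hg)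
      hΛ1 n)
  have hw : ∀ w : W, ‖(w : ℂ)‖ ≤ √p := by
    intro w
    refine Real.le_sqrt_of_sq_le (norm_sq_le_of_powerSum_bound (fun w : W ↦ (w : ℂ)) hp (C := C₀)
      (max m₀ 1) (fun m hm ↦ ?_) w)
    have hm1 : 1 ≤ m := (le_max_right _ _).trans hm
    have h2m : 2 * m ≠ 0 := by omega
    have h1 := hWS (2 * m) (by omega)
    have hfin : finrank (ZMod p) (GaloisField p (2 * m)) = 2 * m := GaloisField.finrank p h2m
    have : Fintype (GaloisField p (2 * m)) := Fintype.ofFinite _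
    have h2 := hbound m ((le_max_left _ _).trans hm) (GaloisField p (2 * m)) hfin
    rw [← hSL, hfin, h1, norm_neg] at h2
    exact h2
  have h1 := hWS 1 one_pos
  have h2 := hSL (ZMod p)
  rw [finrank_self, h1] at h2
  simp only [Algebra.trace_self_apply, Algebra.norm_self, MonoidHom.id_apply, coe_aeval_eq_eval, pow_one] at h2
  rw [← h2, norm_neg]
  calc ‖∑ w : W, (w : ℂ)‖ ≤ ∑ w : W, √p := norm_sum_le_of_le _ fun w _ ↦ hw w
    _ = (F.natDegree + r.natDegree - 1 : ℕ) * √p := by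
      rw [Finset.sum_const, nsmul_eq_mul, Finset.card_univ, Multiset.card_coe, hW]
    _ = _ := by
      rw [hdeg] at hr1 ⊢
      push_cast [Nat.cast_sub (show 1 ≤ F.natDegree + _ from le_add_left hr1)]
      rfl

section Extensions

open Polynomial

variable {K E : Type*} [Field K] [Field E] [Algebra K E] {p : ℕ} [Fact p.Prime]
  [CharP E p]

theorem mem_range_algebraMap_of_pow_eq_self {x : E} (hx : x ^ p = x) :
    x ∈ (algebraMap K E).fieldRange := by
  have : (⊥ : Subfield E) ≤ (algebraMap K E).fieldRange := bot_le
  exact this ((Subfield.mem_bot_iff_pow_eq_self E p).mpr hx)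

variable [IsAlgClosed E]

/-- The degree of an `s`-th root of `u` is `s` when `s ∣ p - 1` and `u` is not an `l`-th power for
any prime divisor `l` of `s`. -/
theorem natDegree_minpoly_of_pow_eq {s : ℕ} (hs0 : s ≠ 0) (hs : s ∣ p - 1) {u : K} (hu0 : u ≠ 0)
    (hu : ∀ l, l.Prime → l ∣ s → ∀ w : K, w ^ l ≠ u) {y : E} (hy : y ^ s = algebraMap K E u) :
    (minpoly K y).natDegree = s := by
  set n := (minpoly K y).natDegree with hn
  have hy0 : y ≠ 0 := by
    rintro rfl
    rw [zero_pow hs0] at hy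
    exact hu0 ((map_eq_zero _).mp hy.symm)
  have hann : ∀ (t : ℕ), t ≠ 0 → ∀ a : K, y ^ t = algebraMap K E a →
      minpoly K y ∣ X ^ t - C a := by
    intro t ht a hta
    exact minpoly.dvd K y (by simp [hta])
  have hintegral : IsIntegral K y := ⟨X ^ s - C u, monic_X_pow_sub_C u hs0, by simp [hy]⟩
  have hn0 : 0 < n := minpoly.natDegree_pos hintegral
  have hdeg : ∀ (t : ℕ), t ≠ 0 → ∀ a : K, y ^ t = algebraMap K E a → n ≤ t := by
    intro t ht a hta
    have := natDegree_le_of_dvd (hann t ht a hta) (X_pow_sub_C_ne_zero (Nat.pos_of_ne_zero ht) a)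
    rwa [natDegree_X_pow_sub_C] at this
  have hyn : y ^ n ∈ (algebraMap K E).fieldRange := by
    set R := ((minpoly K y).map (algebraMap K E)).roots with hR
    have hcard : R.card = n := by
      rw [hR, ← (IsAlgClosed.splits _).natDegree_eq_card_roots, natDegree_map]
    have h1 := (IsAlgClosed.splits ((minpoly K y).map
      (algebraMap K E))).coeff_zero_eq_prod_roots_of_monic ((minpoly.monic hintegral).map _)
    rw [coeff_map, natDegree_map] at h1
    have h2 : (R.map fun b ↦ b / y).prod ∈ (algebraMap K E).fieldRange := by
      refine multiset_prod_mem _ fun z hz ↦ ?_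
      obtain ⟨b, hb, rfl⟩ := Multiset.mem_map.mp hz
      apply mem_range_algebraMap_of_pow_eq_self (p := p)
      have hb0 : aeval b (minpoly K y) = 0 := by
        have := (mem_roots'.mp hb).2
        rwa [IsRoot, eval_map_algebraMap] at this
      have hbs : b ^ s = algebraMap K E u := by
        have := aeval_eq_zero_of_dvd_aeval_eq_zero (hann s hs0 u hy) hb0
        simpa [sub_eq_zero] using this
      have h3 : (b / y) ^ (p - 1) = 1 := by
        obtain ⟨t, ht⟩ := hs
        rw [ht, pow_mul, div_pow, hbs, ← hy, div_self (pow_ne_zero _ hy0), one_pow]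
      calc (b / y) ^ p = (b / y) ^ (p - 1) * (b / y) := by
            rw [← pow_succ, Nat.sub_add_cancel (Fact.out : p.Prime).one_le]
        _ = b / y := by rw [h3, one_mul]
    have h4 : R.prod = y ^ n * (R.map fun b ↦ b / y).prod := by
      rw [Multiset.prod_map_div, Multiset.map_const', Multiset.prod_replicate, hcard]
      simp only [Multiset.map_id']
      field_simp
    have h5 : (R.map fun b ↦ b / y).prod ≠ 0 := by
      intro h0
      have h6 : algebraMap K E ((minpoly K y).coeff 0) = 0 := by rw [h1, ← hR, h4, h0]; simp
      exact minpoly.coeff_zero_ne_zero hintegral hy0 ((map_eq_zero _).mp h6)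
    have h7 : y ^ n = (-1) ^ n * algebraMap K E ((minpoly K y).coeff 0) *
        ((R.map fun b ↦ b / y).prod)⁻¹ := by
      rw [h1, ← hR, h4]
      have : ((-1 : E) ^ n) * (-1) ^ n = 1 := by rw [← mul_pow]; simp
      field_simp
      linear_combination -this
    rw [h7]
    exact mul_mem (mul_mem (pow_mem (neg_mem (one_mem _)) _) ⟨_, rfl⟩) (inv_mem h2)
  obtain ⟨a, ha⟩ := hyn
  have hg : y ^ (n.gcd s) ∈ (algebraMap K E).fieldRange := by
    have h1 : y ^ (n.gcd s) = (y ^ n) ^ (n.gcdA s) * (y ^ s) ^ (n.gcdB s) := by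
      rw [← zpow_natCast y (n.gcd s), Nat.gcd_eq_gcd_ab, zpow_add₀ hy0, zpow_mul, zpow_mul,
        zpow_natCast, zpow_natCast]
    have m1 : y ^ n ∈ (algebraMap K E).fieldRange := ⟨a, ha⟩
    have m2 : y ^ s ∈ (algebraMap K E).fieldRange := ⟨u, hy.symm⟩
    rw [h1]
    exact mul_mem (zpow_mem m1 _) (zpow_mem m2 _)
  obtain ⟨a', ha'⟩ := hg
  have h1 := hdeg _ (Nat.gcd_pos_of_pos_left _ hn0).ne' a' ha'.symm
  have h2 : n ∣ s := by
    have := (Nat.gcd_le_left s hn0).antisymm h1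
    rw [← this]
    exact Nat.gcd_dvd_right _ _
  obtain ⟨e, he⟩ := h2
  by_contra hne
  have he1 : e ≠ 1 := by
    rintro rfl
    rw [mul_one] at he
    exact hne he.symm
  obtain ⟨l, hl, t, rfl⟩ := Nat.exists_prime_and_dvd he1
  refine hu l hl ⟨n * t, by rw [he]; ring⟩ (a ^ t) ((algebraMap K E).injective ?_)
  rw [← hy, he, map_pow, map_pow, ha]
  ring

/-- The degree of a root of `X ^ p - X - v` is `p` when there is no root in the base field. -/
theorem natDegree_minpoly_of_pow_sub_eq {v : K} (hv : ∀ w : K, w ^ p - w ≠ v) {z : E}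
    (hz : z ^ p - z = algebraMap K E v) : (minpoly K z).natDegree = p := by
  have hp : p.Prime := Fact.out
  have hann : aeval z (X ^ p - X - C v) = 0 := by simp [hz]
  have hmon : (X ^ p - X - C v : K[X]).Monic := by
    rw [sub_sub]
    refine monic_X_pow_sub ?_
    rw [degree_X_add_C]
    exact_mod_cast hp.one_lt
  have hnat : (X ^ p - X - C v : K[X]).natDegree = p := by
    rw [sub_sub]
    refine natDegree_eq_of_degree_eq_some ?_
    rw [degree_sub_eq_left_of_degree_lt, degree_X_pow]
    rw [degree_X_add_C, degree_X_pow]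
    exact_mod_cast hp.one_lt
  have hintegral : IsIntegral K z := ⟨_, hmon, hann⟩
  set n := (minpoly K z).natDegree with hn
  have hn0 : 0 < n := minpoly.natDegree_pos hintegral
  have hle : n ≤ p := hnat ▸ natDegree_le_of_dvd (minpoly.dvd K z hann) hmon.ne_zero
  by_contra hne
  have hlt : n < p := lt_of_le_of_ne hle hne
  set R := ((minpoly K z).map (algebraMap K E)).roots with hR
  have hcard : R.card = n := by
    rw [hR, ← (IsAlgClosed.splits _).natDegree_eq_card_roots, natDegree_map]
  have h1 := (IsAlgClosed.splits ((minpoly K z).map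
    (algebraMap K E))).nextCoeff_eq_neg_sum_roots_of_monic ((minpoly.monic hintegral).map _)
  rw [nextCoeff_map (algebraMap K E).injective, ← hR] at h1
  have h2 : (R.map fun b ↦ b - z).sum ∈ (algebraMap K E).fieldRange := by
    refine multiset_sum_mem _ fun x hx ↦ ?_
    obtain ⟨b, hb, rfl⟩ := Multiset.mem_map.mp hx
    apply mem_range_algebraMap_of_pow_eq_self (p := p)
    have hb0 : aeval b (minpoly K z) = 0 := by
      have := (mem_roots'.mp hb).2
      rwa [IsRoot, eval_map_algebraMap] at this
    have h3 := aeval_eq_zero_of_dvd_aeval_eq_zero (minpoly.dvd K z hann) hb0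
    simp only [map_sub, map_pow, aeval_X, aeval_C] at h3
    rw [sub_pow_char]
    linear_combination h3 - hz
  have h4 : R.sum = n * z + (R.map fun b ↦ b - z).sum := by
    rw [Multiset.sum_map_sub, Multiset.map_const', Multiset.sum_replicate, hcard]
    simp
  have hne0 : (n : E) ≠ 0 := by
    rw [Ne, CharP.cast_eq_zero_iff E p]
    exact fun h ↦ absurd (Nat.le_of_dvd hn0 h) (by omega)
  have h5 : z = (-algebraMap K E (minpoly K z).nextCoeff - (R.map fun b ↦ b - z).sum) *
      (n : E)⁻¹ := by
    rw [h1, h4]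
    field_simp
    ring
  have h6 : z ∈ (algebraMap K E).fieldRange := by
    rw [h5]
    exact mul_mem (sub_mem (neg_mem ⟨_, rfl⟩) h2) (inv_mem (natCast_mem _ n))
  obtain ⟨w, hw⟩ := h6
  refine hv w ((algebraMap K E).injective ?_)
  rw [← hz, map_sub, map_pow, hw]

open IntermediateField in
theorem linearIndependent_pow_mul_pow {s : ℕ} (hs0 : s ≠ 0) (hs : s ∣ p - 1) {u v : K}
    (hu0 : u ≠ 0) (hu : ∀ l, l.Prime → l ∣ s → ∀ w : K, w ^ l ≠ u) (hv : ∀ w : K, w ^ p - w ≠ v)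
    {y z : E} (hy : y ^ s = algebraMap K E u) (hz : z ^ p - z = algebraMap K E v) :
    LinearIndependent K fun i : Fin s × Fin p ↦ y ^ (i.1 : ℕ) * z ^ (i.2 : ℕ) := by
  have hp : p.Prime := Fact.out
  have hys := natDegree_minpoly_of_pow_eq hs0 hs hu0 hu hy
  have hzp := natDegree_minpoly_of_pow_sub_eq hv hz
  have hyi : IsIntegral K y := by
    by_contra h
    rw [minpoly.eq_zero h, natDegree_zero] at hys
    exact hs0 hys.symm
  have hzi : IsIntegral K z := by
    by_contra h
    rw [minpoly.eq_zero h, natDegree_zero] at hzp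
    exact hp.ne_zero hzp.symm
  have hcop : (Module.finrank K K⟮y⟯).Coprime (Module.finrank K K⟮z⟯) := by
    rw [adjoin.finrank hyi, adjoin.finrank hzi, hys, hzp]
    refine Nat.Coprime.symm (hp.coprime_iff_not_dvd.mpr fun h ↦ ?_)
    have h1 := Nat.le_of_dvd (by have := hp.two_le; omega) hs
    have h2 := Nat.le_of_dvd (Nat.pos_of_ne_zero hs0) h
    have := hp.two_le
    omega
  have hdisj : K⟮y⟯.LinearDisjoint K⟮z⟯ := .of_finrank_coprime hcop
  have key : ∀ {x : E} {n : ℕ}, (minpoly K x).natDegree = n →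
      LinearIndependent K fun i : Fin n ↦ AdjoinSimple.gen K x ^ (i : ℕ) := by
    rintro x n rfl
    have h1 := linearIndependent_pow (K := K) (AdjoinSimple.gen K x)
    rwa [minpoly_gen K x] at h1
  have h2 := hdisj.linearIndependent_mul (key hys) (key hzp)
  simpa only [SubmonoidClass.coe_pow, AdjoinSimple.coe_gen] using h2

end Extensions

section FractionField

open Polynomial

variable {K : Type*} [Field K]

/-- An equation `w ^ l = c * G ^ (s - 1)` in the field of rational functions forces `l` to divide
the multiplicities of the irreducible factors of `G`. -/
theorem pow_ne_algebraMap_C_mul_pow {s l : ℕ} (hl : l.Prime) (hls : l ∣ s) (hs0 : s ≠ 0)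
    {c : K} (hc : c ≠ 0) {P G' : K[X]} {m : ℕ} (hP : Irreducible P) (hPG : ¬ P ∣ G')
    (hm : ¬ l ∣ m) (w : FractionRing K[X]) :
    w ^ l ≠ algebraMap K[X] (FractionRing K[X]) (C c * (P ^ m * G') ^ (s - 1)) := by
  intro h
  obtain ⟨f, rfl⟩ := IsIntegrallyClosed.exists_algebraMap_eq_of_isIntegral_pow (R := K[X])
    hl.pos (h ▸ isIntegral_algebraMap)
  rw [← map_pow] at h
  have h1 := IsFractionRing.injective K[X] (FractionRing K[X]) h
  have hG'0 : G' ≠ 0 := by rintro rfl; exact hPG (dvd_zero _)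
  have hmul := congrArg (emultiplicity P) h1
  have hC : emultiplicity P (C c) = 0 := by
    rw [emultiplicity_eq_zero]
    exact fun h ↦ hP.not_isUnit (isUnit_of_dvd_unit h (isUnit_C.mpr hc.isUnit))
  rw [emultiplicity_pow hP.prime, emultiplicity_mul hP.prime, emultiplicity_pow hP.prime,
    emultiplicity_mul hP.prime, hC, emultiplicity_eq_zero.mpr hPG,
    emultiplicity_pow_self_of_prime hP.prime, zero_add, add_zero] at hmul
  have hf0 : f ≠ 0 := by
    rintro rfl
    rw [zero_pow hl.ne_zero] at h1
    exact mul_ne_zero (C_ne_zero.mpr hc) (pow_ne_zero _ (mul_ne_zero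
      (pow_ne_zero _ hP.ne_zero) hG'0)) h1.symm
  rw [(FiniteMultiplicity.of_prime_left hP.prime hf0).emultiplicity_eq_multiplicity] at hmul
  have h2 : l * multiplicity P f = (s - 1) * m := by exact_mod_cast hmul
  have h3 : l ∣ (s - 1) * m := ⟨_, h2.symm⟩
  refine hm ((Nat.Coprime.dvd_of_dvd_mul_left ?_ h3))
  rw [hl.coprime_iff_not_dvd]
  intro h4
  have h5 := Nat.dvd_sub hls h4
  rw [Nat.sub_sub_self (Nat.one_le_iff_ne_zero.mpr hs0)] at h5
  exact hl.one_lt.ne' (Nat.dvd_one.mp h5)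

theorem pow_sub_ne_algebraMap {p : ℕ} [Fact p.Prime] {v : K[X]} (hv0 : v.natDegree ≠ 0)
    (hv : v.natDegree < p) (w : FractionRing K[X]) :
    w ^ p - w ≠ algebraMap K[X] (FractionRing K[X]) v := by
  intro h
  have hp : p.Prime := Fact.out
  have hmon : (X ^ p - X - C v : K[X][X]).Monic := by
    rw [sub_sub]
    refine monic_X_pow_sub ?_
    rw [degree_X_add_C]
    exact_mod_cast hp.one_lt
  have hintegral : IsIntegral K[X] w := ⟨_, hmon, by simp [h]⟩
  obtain ⟨f, rfl⟩ := IsIntegrallyClosed.isIntegral_iff.mp hintegral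
  rw [← map_pow, ← map_sub] at h
  have h1 := IsFractionRing.injective K[X] (FractionRing K[X]) h
  rcases Nat.eq_zero_or_pos f.natDegree with h0 | h0
  · rw [eq_C_of_natDegree_eq_zero h0, ← C_pow, ← C_sub] at h1
    rw [← h1, natDegree_C] at hv0
    exact hv0 rfl
  · have h2 : f.natDegree < (f ^ p).natDegree := by
      rw [natDegree_pow]
      exact lt_mul_left h0 hp.one_lt
    have h3 : v.natDegree = p * f.natDegree := by
      rw [← h1, natDegree_sub_eq_left_of_natDegree_lt h2, natDegree_pow]
    have := Nat.le_mul_of_pos_right p h0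
    omega

end FractionField

section NormArgument

open Polynomial

variable {R : Type*} [CommRing R]

/-- The coefficients of `y ^ n` in terms of `1, …, y ^ (s - 1)` when `y ^ s = u`, for `n < 2 * s`. -/
def kummerCoeff (s : ℕ) (u : R) (n i : ℕ) : R :=
  if n < s then (if i = n then 1 else 0) else (if i = n - s then u else 0)

/-- The coefficients of `z ^ n` in terms of `1, …, z ^ (p - 1)` when `z ^ p = z + v`, for
`n < 2 * p - 1`. -/
def artinSchreierCoeff (p : ℕ) (v : R) (n j : ℕ) : R :=
  if n < p then (if j = n then 1 else 0)
  else (if j = n - p + 1 then 1 else 0) + (if j = n - p then v else 0)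

theorem sum_kummerCoeff {S : Type*} [CommRing S] [Algebra R S] {s : ℕ} {u : R} {y : S}
    (hy : y ^ s = algebraMap R S u) {n : ℕ} (hn : n < 2 * s) :
    ∑ i : Fin s, algebraMap R S (kummerCoeff s u n i) * y ^ (i : ℕ) = y ^ n := by
  rw [Fin.sum_univ_eq_sum_range (fun i ↦ algebraMap R S (kummerCoeff s u n i) * y ^ i)]
  by_cases h : n < s
  · simp [kummerCoeff, h, apply_ite (algebraMap R S)]
  · have h1 : n - s < s := by omega
    have h2 : y ^ n = y ^ s * y ^ (n - s) := by rw [← pow_add]; congr 1; omega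
    simp [kummerCoeff, h, apply_ite (algebraMap R S), h1, h2, hy]

theorem sum_artinSchreierCoeff {S : Type*} [CommRing S] [Algebra R S] {p : ℕ} {v : R} {z : S}
    (hz : z ^ p = z + algebraMap R S v) {n : ℕ} (hn : n + 1 < 2 * p) :
    ∑ j : Fin p, algebraMap R S (artinSchreierCoeff p v n j) * z ^ (j : ℕ) = z ^ n := by
  rw [Fin.sum_univ_eq_sum_range (fun j ↦ algebraMap R S (artinSchreierCoeff p v n j) * z ^ j)]
  by_cases h : n < p
  · simp [artinSchreierCoeff, h, apply_ite (algebraMap R S)]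
  · have h1 : n - p < p := by omega
    have h1' : n - p + 1 < p := by omega
    have h2 : z ^ n = z ^ p * z ^ (n - p) := by rw [← pow_add]; congr 1; omega
    simp [artinSchreierCoeff, h, apply_ite (algebraMap R S), h1, h1', h2, hz, add_mul,
      Finset.sum_add_distrib, pow_succ']

/-- The matrix of multiplication by `∑ h i * y ^ i.1 * z ^ i.2` when `y ^ s = u` and
`z ^ p = z + v`. -/
def mulMatrix {s p : ℕ} (u v : R) (h : Fin s × Fin p → R) :
    Matrix (Fin s × Fin p) (Fin s × Fin p) R :=
  Matrix.of fun a b ↦ ∑ i, h i * kummerCoeff s u (a.1 + i.1) b.1 *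
    artinSchreierCoeff p v (a.2 + i.2) b.2

theorem sum_mulMatrix {S : Type*} [CommRing S] [Algebra R S] {s p : ℕ} {u v : R} {y z : S}
    (hy : y ^ s = algebraMap R S u) (hz : z ^ p = z + algebraMap R S v)
    (h : Fin s × Fin p → R) (a : Fin s × Fin p) :
    ∑ b, algebraMap R S (mulMatrix u v h a b) * (y ^ (b.1 : ℕ) * z ^ (b.2 : ℕ)) =
      (∑ i, algebraMap R S (h i) * (y ^ (i.1 : ℕ) * z ^ (i.2 : ℕ))) *
        (y ^ (a.1 : ℕ) * z ^ (a.2 : ℕ)) := by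
  simp only [mulMatrix, Matrix.of_apply, map_sum, Finset.sum_mul]
  rw [Finset.sum_comm]
  refine Finset.sum_congr rfl fun i _ ↦ ?_
  have h1 := sum_kummerCoeff hy (n := a.1 + i.1) (by omega)
  have h2 := sum_artinSchreierCoeff hz (n := a.2 + i.2) (by omega)
  calc _ = algebraMap R S (h i) * (y ^ ((a.1 : ℕ) + i.1) * z ^ ((a.2 : ℕ) + i.2)) := by
        rw [← h1, ← h2, Finset.sum_mul_sum, Fintype.sum_prod_type, Finset.mul_sum]
        refine Finset.sum_congr rfl fun b _ ↦ ?_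
        rw [Finset.mul_sum]
        refine Finset.sum_congr rfl fun c _ ↦ ?_
        simp only [map_mul]
        ring
    _ = _ := by ring

theorem dvd_det_mulMatrix {s p : ℕ} (hs0 : s ≠ 0) (hp0 : p ≠ 0) {u v M y z : R}
    (hy : M ∣ y ^ s - u) (hz : M ∣ z ^ p - z - v) {h : Fin s × Fin p → R}
    (hM : M ∣ ∑ i, h i * (y ^ (i.1 : ℕ) * z ^ (i.2 : ℕ))) : M ∣ (mulMatrix u v h).det := by
  set S := R ⧸ Ideal.span {M} with hS
  have hmk : ∀ a, M ∣ a ↔ algebraMap R S a = 0 := fun a ↦ by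
    rw [← Ideal.mem_span_singleton]
    exact (Ideal.Quotient.eq_zero_iff_mem).symm
  rw [hmk] at hy hz hM ⊢
  have hy' : algebraMap R S y ^ s = algebraMap R S u := by
    rw [← map_pow, ← sub_eq_zero, ← map_sub, hy]
  have hz' : algebraMap R S z ^ p = algebraMap R S z + algebraMap R S v := by
    rw [← map_pow, ← map_add, ← sub_eq_zero, ← map_sub, ← sub_sub, hz]
  simp only [map_sum, map_mul, map_pow] at hM
  set e : Fin s × Fin p → S := fun b ↦ algebraMap R S y ^ (b.1 : ℕ) * algebraMap R S z ^ (b.2 : ℕ)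
  set A := (mulMatrix u v h).map (algebraMap R S) with hA
  have h0 : A.mulVec e = 0 := by
    ext a
    have := sum_mulMatrix hy' hz' h a
    rw [hM, zero_mul] at this
    exact this
  have h1 : A.det • e = 0 := by
    have := congrArg (A.adjugate.mulVec) h0
    rwa [Matrix.mulVec_mulVec, Matrix.adjugate_mul, Matrix.smul_mulVec, Matrix.one_mulVec,
      Matrix.mulVec_zero] at this
  have h2 := congrFun h1 (⟨0, Nat.pos_of_ne_zero hs0⟩, ⟨0, Nat.pos_of_ne_zero hp0⟩)
  simp only [Pi.smul_apply, smul_eq_mul, e, pow_zero, mul_one, Pi.zero_apply] at h2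
  rw [RingHom.map_det]
  exact h2

theorem eq_zero_of_det_mulMatrix_eq_zero [IsDomain R] {E : Type*} [Field E] [Algebra R E]
    [FaithfulSMul R E] {s p : ℕ} {u v : R} {y z : E}
    (hy : y ^ s = algebraMap R E u) (hz : z ^ p = z + algebraMap R E v)
    (hli : LinearIndependent R fun i : Fin s × Fin p ↦ y ^ (i.1 : ℕ) * z ^ (i.2 : ℕ))
    {h : Fin s × Fin p → R} (hdet : (mulMatrix u v h).det = 0) : h = 0 := by
  obtain ⟨c, hc0, hc⟩ := Matrix.exists_vecMul_eq_zero_iff.mpr hdet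
  rw [Fintype.linearIndependent_iff] at hli
  simp only [Algebra.smul_def] at hli
  have key : (∑ i, algebraMap R E (h i) * (y ^ (i.1 : ℕ) * z ^ (i.2 : ℕ))) *
      ∑ a, algebraMap R E (c a) * (y ^ (a.1 : ℕ) * z ^ (a.2 : ℕ)) = 0 := by
    rw [Finset.mul_sum]
    calc _ = ∑ a, algebraMap R E (c a) * ∑ b, algebraMap R E (mulMatrix u v h a b) *
          (y ^ (b.1 : ℕ) * z ^ (b.2 : ℕ)) := by
          refine Finset.sum_congr rfl fun a _ ↦ ?_
          rw [sum_mulMatrix hy hz h a]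
          ring
      _ = ∑ b, algebraMap R E (Matrix.vecMul c (mulMatrix u v h) b) *
          (y ^ (b.1 : ℕ) * z ^ (b.2 : ℕ)) := by
          simp only [Finset.mul_sum]
          rw [Finset.sum_comm]
          refine Finset.sum_congr rfl fun b _ ↦ ?_
          rw [Matrix.vecMul, dotProduct, map_sum, Finset.sum_mul]
          refine Finset.sum_congr rfl fun a _ ↦ ?_
          rw [map_mul]
          ring
      _ = 0 := by simp [hc]
  rcases mul_eq_zero.mp key with h1 | h1
  · exact funext (hli h h1)
  · exact absurd (funext (hli c h1)) hc0

theorem natDegree_det_le_of_forall {n : Type*} [Fintype n] [DecidableEq n] {A : Matrix n n R[X]}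
    {D : ℕ} (hA : ∀ i j, (A i j).natDegree ≤ D) : A.det.natDegree ≤ Fintype.card n * D := by
  rw [Matrix.det_apply]
  refine natDegree_sum_le_of_forall_le _ _ fun σ _ ↦ (natDegree_smul_le _ _).trans ?_
  refine (natDegree_prod_le _ _).trans ?_
  calc _ ≤ ∑ _i : n, D := Finset.sum_le_sum fun i _ ↦ hA _ _
    _ = _ := by simp

theorem natDegree_mulMatrix_le {s p H : ℕ} (u v : R[X]) {h : Fin s × Fin p → R[X]}
    (hH : ∀ i, (h i).natDegree ≤ H) (a b : Fin s × Fin p) :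
    (mulMatrix u v h a b).natDegree ≤ H + u.natDegree + v.natDegree := by
  rw [mulMatrix, Matrix.of_apply]
  refine natDegree_sum_le_of_forall_le _ _ fun i _ ↦ ?_
  refine natDegree_mul_le.trans (add_le_add (natDegree_mul_le.trans (add_le_add (hH i) ?_)) ?_)
  · rw [kummerCoeff]
    split_ifs <;> simp
  · rw [artinSchreierCoeff]
    split_ifs <;> first | simp | exact (natDegree_add_le _ _).trans (by simp)

/-- If `y ^ s` and `z ^ p - z` are congruent to `u` and `v` modulo a polynomial `M` of large degree,
then relations of small degree between the monomials in `y` and `z` modulo `M` are trivial,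
provided that the corresponding monomials in an extension field are linearly independent. -/
theorem eq_zero_of_dvd_sum_mul_pow [IsDomain R] {E : Type*} [Field E] [Algebra R[X] E]
    [FaithfulSMul R[X] E] {s p : ℕ} (hs0 : s ≠ 0) (hp0 : p ≠ 0) {u v : R[X]} {y' z' : E}
    (hy' : y' ^ s = algebraMap R[X] E u) (hz' : z' ^ p = z' + algebraMap R[X] E v)
    (hli : LinearIndependent R[X] fun i : Fin s × Fin p ↦ y' ^ (i.1 : ℕ) * z' ^ (i.2 : ℕ))
    {M y z : R[X]} (hy : M ∣ y ^ s - u) (hz : M ∣ z ^ p - z - v) {h : Fin s × Fin p → R[X]}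
    {H : ℕ} (hH : ∀ i, (h i).natDegree ≤ H)
    (hdeg : s * p * (H + u.natDegree + v.natDegree) < M.natDegree)
    (hM : M ∣ ∑ i, h i * (y ^ (i.1 : ℕ) * z ^ (i.2 : ℕ))) : h = 0 := by
  refine eq_zero_of_det_mulMatrix_eq_zero hy' hz' hli ?_
  by_contra hne
  have h1 := natDegree_le_of_dvd (dvd_det_mulMatrix hs0 hp0 hy hz hM) hne
  have h2 := natDegree_det_le_of_forall (natDegree_mulMatrix_le u v hH)
  rw [Fintype.card_prod, Fintype.card_fin, Fintype.card_fin] at h2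
  omega

end NormArgument

section AuxiliaryPolynomial

open Polynomial

variable {K : Type*} [Field K]

/-- A linear combination with small polynomial coefficients of given bivariate polynomials can be
made divisible by a high power of the inner variable, by counting dimensions. -/
theorem exists_sum_map_mul_eq_C_X_pow_mul {ι : Type*} [Fintype ι] (Ψ : ι → K[X][X]) {D H Q : ℕ}
    (hΨ : ∀ i, (Ψ i).natDegree ≤ D) (hcard : (D + H) * Q < Fintype.card ι * H) :
    ∃ h : ι → K[X], h ≠ 0 ∧ (∀ i, (h i).degree < H) ∧
      ∃ B : K[X][X], ∑ i, (h i).map C * Ψ i = C (X ^ Q) * B := by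
  classical
  let L : (ι → degreeLT K H) →ₗ[K] (Fin (D + H) × Fin Q → K) :=
    { toFun := fun h a ↦ ((∑ i, (h i : K[X]).map C * Ψ i).coeff a.1).coeff a.2
      map_add' := fun f g ↦ by
        ext a
        simp [add_mul, Finset.sum_add_distrib]
      map_smul' := fun t f ↦ by
        ext a
        have : ∑ i, ((t • f) i : K[X]).map C * Ψ i = C (C t) * ∑ i, (f i : K[X]).map C * Ψ i := by
          rw [Finset.mul_sum]
          refine Finset.sum_congr rfl fun i _ ↦ ?_
          rw [Pi.smul_apply, Submodule.coe_smul, smul_eq_C_mul, Polynomial.map_mul, map_C,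
            mul_assoc]
        change ((∑ i, ((t • f) i : K[X]).map C * Ψ i).coeff a.1).coeff a.2 = _
        rw [this, coeff_C_mul, coeff_C_mul]
        rfl }
  have hker : LinearMap.ker L ≠ ⊥ := by
    apply LinearMap.ker_ne_bot_of_finrank_lt
    rw [Module.finrank_fintype_fun_eq_card, Module.finrank_pi_fintype]
    simp only [(degreeLTEquiv K H).finrank_eq, Module.finrank_fintype_fun_eq_card,
      Fintype.card_prod, Fintype.card_fin, Finset.sum_const, Finset.card_univ, smul_eq_mul]
    exact hcard
  obtain ⟨h, hL, h0⟩ := Submodule.exists_mem_ne_zero_of_ne_bot hker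
  refine ⟨fun i ↦ h i, ?_, fun i ↦ mem_degreeLT.mp (h i).2, ?_⟩
  · intro hz
    exact h0 (funext fun i ↦ Subtype.ext (congrFun hz i))
  · change (C (X ^ Q) : K[X][X]) ∣ _
    rw [C_dvd_iff_dvd_coeff]
    intro a
    rw [X_pow_dvd_iff]
    intro l hl
    by_cases ha : a < D + H
    · exact congrFun (LinearMap.mem_ker.mp hL) (⟨a, ha⟩, ⟨l, hl⟩)
    · rw [finsetSum_coeff, Finset.sum_eq_zero, coeff_zero]
      intro i _
      change ((h i : K[X]).map C * Ψ i).coeff a = 0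
      rcases Nat.eq_zero_or_pos H with hH | hH
      · subst hH
        have h1 := mem_degreeLT.mp (h i).2
        have h2 : (h i : K[X]) = 0 := by
          rw [← degree_eq_bot]
          simpa [Nat.WithBot.lt_zero_iff] using h1
        rw [h2]
        simp
      · refine coeff_eq_zero_of_natDegree_lt ?_
        have h1 : (h i : K[X]).natDegree < H := by
          rcases eq_or_ne (h i : K[X]) 0 with h2 | h2
          · rw [h2]; simpa using hH
          · exact (natDegree_lt_iff_degree_lt h2).mpr (mem_degreeLT.mp (h i).2)
        have h2 := natDegree_mul_le (p := (h i : K[X]).map C) (q := Ψ i)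
        have h3 := hΨ i
        have h4 : ((h i : K[X]).map C).natDegree ≤ (h i : K[X]).natDegree := natDegree_map_le
        omega

theorem card_mul_le_natDegree_of_X_sub_C_pow_dvd {R : K[X]} (hR : R ≠ 0) (Z : Finset K) {Q : ℕ}
    (h : ∀ x ∈ Z, (X - C x) ^ Q ∣ R) : Z.card * Q ≤ R.natDegree := by
  have h1 : ∏ x ∈ Z, (X - C x) ^ Q ∣ R := by
    refine Finset.prod_dvd_of_coprime (fun x _ y _ hxy ↦ ?_) h
    exact (pairwise_coprime_X_sub_C Function.injective_id hxy).pow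
  have h2 := natDegree_le_of_dvd h1 hR
  rw [natDegree_prod_of_monic _ _ fun x _ ↦ (monic_X_sub_C x).pow Q] at h2
  simpa [natDegree_pow] using h2

end AuxiliaryPolynomial

section NonVanishing

open Polynomial

theorem dvd_of_sum_mul_pow_eq_zero {R : Type*} [CommRing R] [IsDomain R] {κ : ℕ} {M : R}
    (hM : M ≠ 0) {a : Fin κ → R} (ha : ∑ j, a j * M ^ (j : ℕ) = 0) (k : Fin κ)
    (hk : ∀ j < k, a j = 0) : M ∣ a k := by
  rw [← Finset.add_sum_erase _ _ (Finset.mem_univ k)] at ha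
  have h1 : M ^ ((k : ℕ) + 1) ∣ ∑ j ∈ Finset.univ.erase k, a j * M ^ (j : ℕ) := by
    refine Finset.dvd_sum fun j hj ↦ ?_
    rcases lt_or_gt_of_ne (Finset.ne_of_mem_erase hj) with h | h
    · rw [hk j h, zero_mul]
      exact dvd_zero _
    · exact Dvd.dvd.mul_left (pow_dvd_pow _ h) _
  have h2 : M ^ (k : ℕ) * M ∣ M ^ (k : ℕ) * a k := by
    rw [← pow_succ, mul_comm _ (a k)]
    exact (dvd_add_left h1).mp (ha.symm ▸ dvd_zero _)
  exact (mul_dvd_mul_iff_left (pow_ne_zero _ hM)).mp h2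

theorem X_sub_C_pow_dvd_pow_sub_C {K : Type*} [Field K] (p : ℕ) [Fact p.Prime] [CharP K p] (n : ℕ)
    (A : K[X]) (x : K) : (X - C x) ^ p ^ n ∣ A ^ p ^ n - C (A.eval x ^ p ^ n) := by
  rw [C_pow, ← sub_pow_char_pow]
  exact pow_dvd_pow_of_dvd X_sub_C_dvd_sub_C_eval _

/-- The auxiliary polynomial in the Stepanov method does not vanish. -/
theorem eq_zero_of_sum_mul_pow_eq_zero {K : Type*} [Field K] [Fintype K] {p : ℕ} [Fact p.Prime]
    [CharP K p] {s n : ℕ} (hs0 : s ≠ 0) (hs : s ∣ p - 1) (hn : Fintype.card K = p ^ n)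
    {F G : K[X]} (hF0 : F.natDegree ≠ 0) (hF : F.natDegree < p)
    (hG : ∀ l : ℕ, l.Prime → l ∣ s → ∃ (P G' : K[X]) (k : ℕ),
      Irreducible P ∧ G = P ^ k * G' ∧ ¬ P ∣ G' ∧ ¬ l ∣ k)
    {τ : K} (hτ : G.eval τ ≠ 0) {y z : K[X]} (hy : y ^ s = G ^ (s - 1) * G ^ p ^ n)
    (hz : z ^ p - z = F ^ p ^ n - F) {κ H : ℕ} {h : (Fin s × Fin p) × Fin κ → K[X]}
    (hH : ∀ i, (h i).natDegree ≤ H)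
    (hdeg : s * p * (H + (s - 1) * G.natDegree + F.natDegree) < p ^ n)
    (hsum : ∑ i, h i * (y ^ (i.1.1 : ℕ) * z ^ (i.1.2 : ℕ)) * ((X - C τ) ^ p ^ n) ^ (i.2 : ℕ) = 0) :
    h = 0 := by
  have hp := (Fact.out : p.Prime)
  let L := FractionRing K[X]
  let E := AlgebraicClosure L
  have : CharP K[X] p := inferInstance
  have : CharP L p := charP_of_injective_algebraMap (IsFractionRing.injective K[X] L) p
  have : CharP E p := charP_of_injective_algebraMap (algebraMap L E).injective p
  set u : K[X] := C (G.eval τ) * G ^ (s - 1) with hu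
  set v : K[X] := C (F.eval τ) - F with hv
  have hG0 : G ≠ 0 := by
    rintro rfl
    simp at hτ
  have hvdeg : v.natDegree = F.natDegree := by
    rw [hv, ← natDegree_neg, neg_sub, natDegree_sub_C]
  have hudeg : u.natDegree = (s - 1) * G.natDegree := by
    rw [hu, natDegree_C_mul hτ, natDegree_pow]
  have hcard : ∀ x : K, x ^ p ^ n = x := fun x ↦ hn ▸ FiniteField.pow_card x
  obtain ⟨y', hy'⟩ := IsAlgClosed.exists_pow_nat_eq (algebraMap K[X] E u) (Nat.pos_of_ne_zero hs0)
  obtain ⟨z', hz'⟩ : ∃ z' : E, z' ^ p - z' = algebraMap K[X] E v := by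
    have h1 : ((X : E[X]) ^ p - X - C (algebraMap K[X] E v)).degree ≠ 0 := by
      have : (X ^ p - X - C (algebraMap K[X] E v) : E[X]) = X ^ p - (X + C (algebraMap K[X] E v)) := by
        ring
      rw [this, degree_sub_eq_left_of_degree_lt]
      · rw [degree_X_pow]
        exact_mod_cast hp.ne_zero
      · rw [degree_X_add_C, degree_X_pow]
        exact_mod_cast hp.one_lt
    obtain ⟨z', hz'⟩ := IsAlgClosed.exists_root _ h1
    refine ⟨z', ?_⟩
    simpa [IsRoot, sub_eq_zero] using hz'
  have hli : LinearIndependent L fun i : Fin s × Fin p ↦ y' ^ (i.1 : ℕ) * z' ^ (i.2 : ℕ) := by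
    refine linearIndependent_pow_mul_pow (K := L) (u := algebraMap K[X] L u)
      (v := algebraMap K[X] L v) hs0 hs ?_ ?_ ?_ ?_ ?_
    · rw [Ne, FaithfulSMul.algebraMap_eq_zero_iff]
      exact mul_ne_zero (C_ne_zero.mpr hτ) (pow_ne_zero _ hG0)
    · intro l hl hls w
      obtain ⟨P, G', k, hP, hPG, hG', hk⟩ := hG l hl hls
      rw [hu]
      nth_rewrite 2 [hPG]
      exact pow_ne_algebraMap_C_mul_pow hl hls hs0 hτ hP hG' hk w
    · exact pow_sub_ne_algebraMap (hvdeg ▸ hF0) (hvdeg ▸ hF)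
    · rw [hy', IsScalarTower.algebraMap_apply K[X] L E]
    · rw [hz', IsScalarTower.algebraMap_apply K[X] L E]
  have hli' := (LinearIndependent.iff_fractionRing K[X] L).mpr hli
  have : FaithfulSMul K[X] E := by
    rw [faithfulSMul_iff_algebraMap_injective, IsScalarTower.algebraMap_eq K[X] L E]
    exact (algebraMap L E).injective.comp (IsFractionRing.injective K[X] L)
  set M : K[X] := (X - C τ) ^ p ^ n with hM
  have hMdeg : M.natDegree = p ^ n := by rw [hM, natDegree_pow, natDegree_X_sub_C, mul_one]
  have hM0 : M ≠ 0 := pow_ne_zero _ (X_sub_C_ne_zero τ)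
  have hMy : M ∣ y ^ s - u := by
    have := X_sub_C_pow_dvd_pow_sub_C p n G τ
    rw [hcard] at this
    rw [hy, hu, mul_comm (C _), ← mul_sub]
    exact this.mul_left _
  have hMz : M ∣ z ^ p - z - v := by
    have := X_sub_C_pow_dvd_pow_sub_C p n F τ
    rw [hcard] at this
    rw [hz, hv]
    convert this using 1
    ring
  have key : ∀ k : Fin κ, ∀ i, h (i, k) = 0 := by
    intro k
    induction k using WellFoundedLT.induction with
    | ind k ih =>
      have h1 : M ∣ ∑ i, h (i, k) * (y ^ (i.1 : ℕ) * z ^ (i.2 : ℕ)) := by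
        refine dvd_of_sum_mul_pow_eq_zero
          (a := fun k ↦ ∑ i, h (i, k) * (y ^ (i.1 : ℕ) * z ^ (i.2 : ℕ))) hM0 ?_ k ?_
        · rw [← hsum, Fintype.sum_prod_type_right]
          exact Finset.sum_congr rfl fun k _ ↦ by rw [Finset.sum_mul]
        · intro j hj
          exact Finset.sum_eq_zero fun i _ ↦ by rw [ih j hj i, zero_mul]
      have h2 := eq_zero_of_dvd_sum_mul_pow hs0 hp.ne_zero hy' (by rw [← hz']; ring) hli' hMy hMz
        (h := fun i ↦ h (i, k)) (fun i ↦ hH _) (by rwa [hMdeg, hudeg, hvdeg]) h1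
      exact fun i ↦ congrFun h2 i
  exact funext fun i ↦ key i.2 i.1

end NonVanishing

section Vanishing

open Polynomial

variable {K : Type*} [Field K]

/-- The substitution `X ↦ X`, `ε ↦ x - X` on `K[ε][X]`. -/
noncomputable def evalInnerSub (x : K) : K[X][X] →+* K[X] :=
  eval₂RingHom (compRingHom (C x - X)) X

theorem evalInnerSub_X (x : K) : evalInnerSub x X = X := by
  simp [evalInnerSub]

theorem evalInnerSub_C (x : K) (b : K[X]) : evalInnerSub x (C b) = b.comp (C x - X) := by
  simp [evalInnerSub]

theorem evalInnerSub_map_C (x : K) (f : K[X]) : evalInnerSub x (f.map C) = f := by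
  rw [evalInnerSub, coe_eval₂RingHom, eval₂_map]
  have : (compRingHom (C x - X)).comp C = (C : K →+* K[X]) := by
    ext
    simp
  rw [this, eval₂_C_X]

theorem evalInnerSub_map_C_comp (x : K) (f : K[X]) :
    evalInnerSub x ((f.map C).comp (X + C X)) = C (f.eval x) := by
  rw [comp, eval₂_map, hom_eval₂, map_add, evalInnerSub_X, evalInnerSub_C]
  have : (evalInnerSub x).comp (C.comp C) = (C : K →+* K[X]) := by
    ext
    simp [evalInnerSub_C]
  rw [this, X_comp, add_sub_cancel, eval₂_at_apply]

/-- The bivariate polynomials representing the functions `y ^ i * T ^ j * (X - τ) ^ (q * k)` to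
high order near the points under consideration. -/
noncomputable def stepanovFamily {s p κ : ℕ} (G T : K[X]) (τ c a : K) (e : ℕ)
    (i : (Fin s × Fin p) × Fin κ) : K[X][X] :=
  C (C (c ^ (i.1.1 : ℕ))) * (G.map C) ^ ((1 + e) * i.1.1) *
    ((G.map C).comp (X + C X)) ^ (e * (s - 1 - i.1.1)) *
    (T.map C - (T.map C).comp (X + C X) + C (C a)) ^ (i.1.2 : ℕ) *
    (X + C X - C (C τ)) ^ (i.2 : ℕ)

theorem natDegree_map_C_comp_le (f : K[X]) :
    ((f.map C).comp (X + C X : K[X][X])).natDegree ≤ f.natDegree := by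
  rw [natDegree_comp, natDegree_X_add_C, mul_one]
  exact natDegree_map_le

theorem natDegree_stepanovFamily_le {s p κ : ℕ} (G T : K[X]) (τ c a : K) (e : ℕ)
    (i : (Fin s × Fin p) × Fin κ) :
    (stepanovFamily G T τ c a e i).natDegree ≤
      (s + e * s) * G.natDegree + (p - 1) * T.natDegree + κ := by
  have h1 := natDegree_map_C_comp_le G
  have h2 := natDegree_map_C_comp_le T
  have h3 : (G.map (C : K →+* K[X])).natDegree ≤ G.natDegree := natDegree_map_le
  have h4 : (T.map (C : K →+* K[X])).natDegree ≤ T.natDegree := natDegree_map_le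
  have h5 : (T.map C - (T.map C).comp (X + C X : K[X][X]) + C (C a)).natDegree ≤ T.natDegree := by
    rw [natDegree_add_C]
    exact (natDegree_sub_le _ _).trans (max_le h4 h2)
  have h6 : (X + C X - C (C τ) : K[X][X]).natDegree ≤ 1 := by
    rw [natDegree_sub_C, natDegree_X_add_C]
  have hs := i.1.1.2
  have hp := i.1.2.2
  have hκ := i.2.2
  have e1 : (C (C (c ^ (i.1.1 : ℕ))) * (G.map C) ^ ((1 + e) * i.1.1) : K[X][X]).natDegree ≤
      (1 + e) * i.1.1 * G.natDegree :=
    (natDegree_C_mul_le _ _).trans ((natDegree_pow_le_of_le _ h3))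
  have e2 := natDegree_pow_le_of_le (e * (s - 1 - i.1.1)) h1
  have e3 := natDegree_pow_le_of_le (i.1.2 : ℕ) h5
  have e4 := natDegree_pow_le_of_le (i.2 : ℕ) h6
  have := natDegree_mul_le_of_le (natDegree_mul_le_of_le (natDegree_mul_le_of_le e1 e2) e3) e4
  refine this.trans ?_
  have f1 : (1 + e) * i.1.1 * G.natDegree + e * (s - 1 - i.1.1) * G.natDegree ≤
      (s + e * s) * G.natDegree := by
    rw [← add_mul]
    refine Nat.mul_le_mul_right _ ?_
    obtain ⟨t, ht⟩ : ∃ t, s = i.1.1 + 1 + t := ⟨s - 1 - i.1.1, by omega⟩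
    have : s - 1 - i.1.1 = t := by omega
    rw [this]
    nlinarith
  have f2 : (i.1.2 : ℕ) * T.natDegree ≤ (p - 1) * T.natDegree := by
    gcongr
    omega
  omega

theorem X_sub_C_pow_dvd_of_stepanovFamily {p : ℕ} [Fact p.Prime] [CharP K p] [Fintype K] {s m e κ : ℕ}
    (hK : Fintype.card K = p ^ (2 * m)) {G T : K[X]} {τ c a x : K} (hx : G.eval x ≠ 0)
    (hc : G.eval x ^ (e * (p ^ m + 1)) = c) (ha : (T + T ^ p ^ m).eval x = a)
    {h : (Fin s × Fin p) × Fin κ → K[X]} {B : K[X][X]}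
    (hB : ∑ i, (h i).map C * stepanovFamily G T τ c a e i = C (X ^ p ^ m) * B) :
    (X - C x) ^ p ^ m ∣ ∑ i, h i * ((G ^ (1 + e * (p ^ m + 1))) ^ (i.1.1 : ℕ) *
      (T + T ^ p ^ m) ^ (i.1.2 : ℕ)) * ((X - C τ) ^ p ^ (2 * m)) ^ (i.2 : ℕ) := by
  set N : K[X] := (X - C x) ^ p ^ m with hN
  let π := Ideal.Quotient.mk (Ideal.span {N})
  have hπ : ∀ f g : K[X], N ∣ f - g → π f = π g := fun f g hfg ↦
    Ideal.Quotient.eq.mpr (Ideal.mem_span_singleton.mpr hfg)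
  have hcard : ∀ z : K, (z ^ p ^ m) ^ p ^ m = z := fun z ↦ by
    rw [← pow_mul, ← pow_add, ← two_mul, ← hK, FiniteField.pow_card]
  have hT : π (T + T ^ p ^ m) = π (T - C (T.eval x) + C a) := by
    refine hπ _ _ ?_
    have : T + T ^ p ^ m - (T - C (T.eval x) + C a) = T ^ p ^ m - C (T.eval x ^ p ^ m) := by
      rw [← ha]
      simp only [eval_add, eval_pow, C_add, C_pow]
      ring
    rw [this]
    exact X_sub_C_pow_dvd_pow_sub_C p m T x
  have hX : π ((X - C τ) ^ p ^ (2 * m)) = π (C x - C τ) := by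
    refine hπ _ _ ?_
    have h1 := X_sub_C_pow_dvd_pow_sub_C p (2 * m) (X - C τ) x
    rw [← hK, FiniteField.pow_card, eval_sub, eval_X, eval_C, C_sub, hK] at h1
    refine (pow_dvd_pow _ ?_).trans h1
    exact Nat.pow_le_pow_right (Fact.out : p.Prime).pos (by omega)
  have hG : π (C (G.eval x ^ e)) * π (G ^ (1 + e * (p ^ m + 1))) =
      π (C c) * π (G ^ (1 + e)) := by
    rw [← map_mul, ← map_mul]
    refine hπ _ _ ?_
    have : C (G.eval x ^ e) * G ^ (1 + e * (p ^ m + 1)) - C c * G ^ (1 + e) =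
        C (G.eval x ^ e) * G ^ (1 + e) * ((G ^ e) ^ p ^ m - C ((G ^ e).eval x ^ p ^ m)) := by
      rw [← hc]
      simp only [C_pow, eval_pow]
      ring
    rw [this]
    exact (X_sub_C_pow_dvd_pow_sub_C p m (G ^ e) x).mul_left _
  have hterm : ∀ i : (Fin s × Fin p) × Fin κ,
      π (C (G.eval x ^ (e * (s - 1)))) * π (h i * ((G ^ (1 + e * (p ^ m + 1))) ^ (i.1.1 : ℕ) *
      (T + T ^ p ^ m) ^ (i.1.2 : ℕ)) * ((X - C τ) ^ p ^ (2 * m)) ^ (i.2 : ℕ)) =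
      π (evalInnerSub x ((h i).map C * stepanovFamily G T τ c a e i)) := by
    intro i
    have hi := i.1.1.2
    obtain ⟨t, ht⟩ : ∃ t, s = i.1.1 + 1 + t := ⟨s - 1 - i.1.1, by omega⟩
    have ht1 : s - 1 - i.1.1 = t := by omega
    have ht2 : s - 1 = i.1.1 + t := by omega
    simp only [stepanovFamily, map_mul, map_pow, map_add, map_sub, evalInnerSub_map_C,
      evalInnerSub_map_C_comp, evalInnerSub_X]
    simp only [evalInnerSub_C, C_comp, X_comp, ht1]
    simp only [map_pow, map_add, map_sub] at hT hX hG
    rw [hT, hX, ht2]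
    have hG' := congrArg (· ^ (i.1.1 : ℕ)) hG
    simp only [mul_pow] at hG'
    simp only [map_sub]
    have : π (C (G.eval x)) ^ (e * (i.1.1 + t)) =
      (π (C (G.eval x)) ^ e) ^ (i.1.1 : ℕ) * π (C (G.eval x)) ^ (e * t) := by ring
    rw [this, pow_mul (π G) (1 + e)]
    linear_combination (π (C (G.eval x)) ^ (e * t) * π (h i) *
      (π T - π (C (T.eval x)) + π (C a)) ^ (i.1.2 : ℕ) *
      (π (C x) - π (C τ)) ^ (i.2 : ℕ)) * hG'
  have hzero : π (evalInnerSub x (C (X ^ p ^ m) * B)) = 0 := by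
    rw [Ideal.Quotient.eq_zero_iff_mem, Ideal.mem_span_singleton, map_mul, evalInnerSub_C,
      X_pow_comp, ← neg_sub, neg_pow, mul_assoc]
    exact ((dvd_refl _).mul_right _).mul_left _
  have hsum := hzero
  rw [← hB, map_sum, map_sum, ← Finset.sum_congr rfl fun i _ ↦ hterm i, ← Finset.mul_sum,
    ← map_sum, ← map_mul, Ideal.Quotient.eq_zero_iff_mem, Ideal.mem_span_singleton] at hsum
  refine (IsUnit.dvd_mul_left ?_).mp hsum
  exact isUnit_C.mpr (isUnit_iff_ne_zero.mpr (pow_ne_zero _ hx))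

end Vanishing

section Count

open Polynomial

/-- The numerical inequality behind the choice of parameters in the Stepanov method. -/
theorem stepanov_parameters {N g d Q c w : ℕ} (hN : 2 ≤ N) (hc : c = 4 * (g + d + 2) + 1)
    (hQ : 4 * N * (w + d + 1) + c ≤ Q) :
    (w + Q * g + d * Q + (Q / N + c) + Q ^ 2 / (2 * N)) * Q <
      N * (Q / N + c) * (Q ^ 2 / (2 * N)) := by
  have h1 : Q < N * (Q / N + 1) := Nat.lt_mul_div_succ Q (by omega)
  have h2 : Q ^ 2 < 2 * N * (Q ^ 2 / (2 * N) + 1) := Nat.lt_mul_div_succ _ (by omega)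
  have h3 : Q / N * 2 ≤ Q := by
    have := Nat.div_mul_le_self Q N
    nlinarith
  set H := Q ^ 2 / (2 * N)
  set k := Q / N
  have hw : w + d + 1 ≤ N * (w + d + 1) := Nat.le_mul_of_pos_left _ (by omega)
  have h4 : w + Q * g + d * Q + (k + c) ≤ (g + d + 2) * Q := by nlinarith
  have h5 : 4 * N ≤ Q := by nlinarith
  have h6 : Q ^ 2 ≤ 4 * N * H := by nlinarith
  have hH : 0 < H := by
    refine Nat.pos_of_ne_zero fun hH ↦ ?_
    rw [hH] at h6
    nlinarith
  have h7 : Q + N * (4 * (g + d + 2)) + 1 ≤ N * (k + c) := by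
    rw [hc]
    nlinarith
  calc (w + Q * g + d * Q + (k + c) + H) * Q ≤ ((g + d + 2) * Q + H) * Q := by gcongr
    _ = (g + d + 2) * Q ^ 2 + H * Q := by ring
    _ ≤ (g + d + 2) * (4 * N * H) + H * Q := by gcongr
    _ < (Q + N * (4 * (g + d + 2)) + 1) * H := by nlinarith
    _ ≤ _ := by gcongr

theorem natDegree_sum_pow_le {K : Type*} [Field K] (F : K[X]) {p : ℕ} (hp : 1 ≤ p) (n : ℕ) :
    (∑ i ∈ Finset.range n, F ^ p ^ i).natDegree ≤ p ^ (n - 1) * F.natDegree := by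
  refine natDegree_sum_le_of_forall_le _ _ fun i hi ↦ ?_
  rw [Finset.mem_range] at hi
  rw [natDegree_pow]
  gcongr
  omega

/-- Stepanov's bound for the number of points where a power function and an additive trace
simultaneously take prescribed values. -/
theorem card_mul_le_of_forall_eval_pow_eq {K : Type*} [Field K] [Fintype K] {p : ℕ} [Fact p.Prime]
    [CharP K p] {s m : ℕ} (hs0 : s ≠ 0) (hs : s ∣ p - 1) (hK : Fintype.card K = p ^ (2 * m))
    {F G : K[X]} (hF0 : F.natDegree ≠ 0) (hF : F.natDegree < p)
    (hG : ∀ l : ℕ, l.Prime → l ∣ s → ∃ (P G' : K[X]) (k : ℕ),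
      Irreducible P ∧ G = P ^ k * G' ∧ ¬ P ∣ G' ∧ ¬ l ∣ k) (hG0 : G ≠ 0)
    (hm : 4 * (s * p) * (s * G.natDegree + F.natDegree + 1) +
      (4 * (G.natDegree + F.natDegree + 2) + 1) ≤ p ^ m)
    (c a : K) (Z : Finset K)
    (hZ : ∀ x ∈ Z, G.eval x ≠ 0 ∧ G.eval x ^ ((p ^ (2 * m) - 1) / s) = c ∧
      ∑ i ∈ Finset.range (2 * m), F.eval x ^ p ^ i = a) :
    s * p * Z.card ≤ p ^ (2 * m) + s * p * (5 * (G.natDegree + F.natDegree) + 11) * p ^ m := by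
  have hp := (Fact.out : p.Prime)
  set g := G.natDegree with hg
  set d := F.natDegree with hd
  set Q := p ^ m with hQ
  have hq : p ^ (2 * m) = Q ^ 2 := by rw [hQ, ← pow_mul, mul_comm]
  have hs1 : 1 ≤ s := Nat.one_le_iff_ne_zero.mpr hs0
  have hN : 2 ≤ s * p := hp.two_le.trans (Nat.le_mul_of_pos_left _ hs1)
  have hQ1 : 1 ≤ Q := Nat.one_le_pow _ _ hp.pos
  obtain ⟨e, he⟩ : s ∣ Q - 1 := hs.trans (by simpa using Nat.sub_dvd_pow_sub_pow p 1 m)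
  have hes : e * s + 1 = Q := by rw [mul_comm]; omega
  have he' : (p ^ (2 * m) - 1) / s = e * (Q + 1) := by
    refine Nat.div_eq_of_eq_mul_right hs1 ?_
    rw [hq, Nat.sub_eq_iff_eq_add (Nat.one_le_pow _ _ hQ1), ← hes]
    ring
  set T : K[X] := ∑ i ∈ Finset.range m, F ^ p ^ i with hT
  have hm0 : m ≠ 0 := by
    rintro rfl
    rw [pow_zero] at hQ
    omega
  have hTdeg : (p - 1) * T.natDegree ≤ d * Q := by
    have h1 := natDegree_sum_pow_le F hp.one_le m
    obtain ⟨n, rfl⟩ := Nat.exists_eq_succ_of_ne_zero hm0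
    rw [hQ, pow_succ]
    rw [Nat.succ_sub_one] at h1
    calc (p - 1) * T.natDegree ≤ p * (p ^ n * d) := Nat.mul_le_mul (Nat.sub_le _ _) h1
      _ = _ := by ring
  have hTT : ∑ i ∈ Finset.range (2 * m), F ^ p ^ i = T + T ^ Q := by
    rw [two_mul, Finset.sum_range_add, hT, hQ, sum_pow_char_pow]
    simp_rw [← pow_mul, ← pow_add, add_comm m]
  set κ := Q / (s * p) + (4 * (g + d + 2) + 1) with hκ
  set H := Q ^ 2 / (2 * (s * p)) with hH
  obtain ⟨τ, hτ⟩ : ∃ τ : K, G.eval τ ≠ 0 := by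
    by_contra! hall
    refine hG0 (eq_zero_of_natDegree_lt_card_of_eval_eq_zero' G Finset.univ (fun x _ ↦ hall x) ?_)
    rw [Finset.card_univ, hK, hq]
    have : Q ≤ Q ^ 2 := by nlinarith
    omega
  obtain ⟨h, h0, hdeg, B, hB⟩ := exists_sum_map_mul_eq_C_X_pow_mul
    (stepanovFamily (s := s) (p := p) (κ := κ) G T τ c a e) (D := s * g + Q * g + d * Q + κ) (H := H)
    (Q := Q) (fun i ↦ (natDegree_stepanovFamily_le G T τ c a e i).trans (by nlinarith)) (by
      simp only [Fintype.card_prod, Fintype.card_fin]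
      exact stepanov_parameters hN rfl hm)
  have hdeg' : ∀ i, (h i).natDegree ≤ H := fun i ↦ natDegree_le_of_degree_le (hdeg i).le
  set y : K[X] := G ^ (1 + e * (Q + 1)) with hy
  set R : K[X] := ∑ i, h i * (y ^ (i.1.1 : ℕ) * (T + T ^ Q) ^ (i.1.2 : ℕ)) *
    ((X - C τ) ^ p ^ (2 * m)) ^ (i.2 : ℕ) with hR
  have hR0 : R ≠ 0 := by
    intro hR0
    refine h0 (eq_zero_of_sum_mul_pow_eq_zero hs0 hs hK hF0 hF hG hτ ?_ ?_ hdeg' ?_ hR0)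
    · rw [hy, ← pow_mul, ← pow_add, hq, ← hes]
      congr 1
      obtain ⟨t, rfl⟩ := Nat.exists_eq_succ_of_ne_zero hs0
      rw [Nat.succ_sub_one, Nat.succ_eq_add_one]
      ring
    · rw [← hTT, sum_pow_char]
      simp_rw [← pow_mul, ← pow_succ]
      rw [← Finset.sum_sub_distrib, Finset.sum_range_sub fun i ↦ F ^ p ^ i, pow_zero, pow_one]
    · have h1 : H * (2 * (s * p)) ≤ Q ^ 2 := Nat.div_mul_le_self _ _
      have h2 : (s - 1) * g ≤ s * g := by gcongr; omega
      rw [hq, ← hg, ← hd]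
      nlinarith
  have hcount := card_mul_le_natDegree_of_X_sub_C_pow_dvd hR0 Z (Q := Q) (fun x hx ↦ by
    obtain ⟨h1, h2, h3⟩ := hZ x hx
    refine X_sub_C_pow_dvd_of_stepanovFamily hK h1 (he' ▸ h2) ?_ hB
    rw [← h3, ← hTT, eval_finsetSum]
    simp only [eval_pow])
  have hRdeg : R.natDegree ≤ H + (g * (s + Q ^ 2) + d * Q ^ 2) + Q ^ 2 * κ := by
    refine natDegree_sum_le_of_forall_le _ _ fun i _ ↦ ?_
    have h1 : (y ^ (i.1.1 : ℕ)).natDegree ≤ g * (s + Q ^ 2) := by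
      rw [hy, ← pow_mul, natDegree_pow, mul_comm]
      refine Nat.mul_le_mul_left _ ?_
      have : (1 + e * (Q + 1)) * i.1.1 ≤ (1 + e * (Q + 1)) * s := Nat.mul_le_mul_left _ i.1.1.2.le
      nlinarith
    have h2 : ((T + T ^ Q) ^ (i.1.2 : ℕ)).natDegree ≤ d * Q ^ 2 := by
      have h3 := natDegree_sum_pow_le F hp.one_le (2 * m)
      rw [hTT] at h3
      rw [natDegree_pow]
      calc (i.1.2 : ℕ) * (T + T ^ Q).natDegree ≤ p * (p ^ (2 * m - 1) * d) :=
            Nat.mul_le_mul i.1.2.2.le h3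
        _ = p ^ (2 * m - 1 + 1) * d := by ring
        _ = d * Q ^ 2 := by rw [Nat.sub_add_cancel (by omega), hq, mul_comm]
    have h3 : (((X - C τ) ^ p ^ (2 * m)) ^ (i.2 : ℕ)).natDegree ≤ Q ^ 2 * κ := by
      rw [natDegree_pow, natDegree_pow, natDegree_X_sub_C, mul_one, hq, mul_comm]
      exact Nat.mul_le_mul_left _ i.2.2.le
    exact natDegree_mul_le_of_le (natDegree_mul_le_of_le (hdeg' i)
      (natDegree_mul_le_of_le h1 h2)) h3
  have h1 : H ≤ Q ^ 2 := Nat.div_le_self _ _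
  have h2 : g * s ≤ Q ^ 2 := by
    have e1 : s * g + d + 1 ≤ 4 * (s * p) * (s * g + d + 1) :=
      Nat.le_mul_of_pos_left _ (by omega)
    have e2 : Q ≤ Q ^ 2 := Nat.le_self_pow two_ne_zero Q
    rw [mul_comm g]
    omega
  have h3 : Z.card * Q ≤ (Q * (g + d + 2 + κ)) * Q := by
    refine hcount.trans (hRdeg.trans ?_)
    calc H + (g * (s + Q ^ 2) + d * Q ^ 2) + Q ^ 2 * κ
        = H + g * s + Q ^ 2 * (g + d + κ) := by ring
      _ ≤ Q ^ 2 + Q ^ 2 + Q ^ 2 * (g + d + κ) := by gcongr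
      _ = _ := by ring
  have h4 := Nat.le_of_mul_le_mul_right h3 hQ1
  have h5 : Q / (s * p) * (s * p) ≤ Q := Nat.div_mul_le_self _ _
  have h6 : s * p * κ ≤ Q + s * p * (4 * (g + d + 2) + 1) := by
    rw [hκ, mul_add]
    linarith
  rw [hq]
  calc s * p * Z.card ≤ s * p * (Q * (g + d + 2 + κ)) := Nat.mul_le_mul_left _ h4
    _ = Q * (s * p * κ + s * p * (g + d + 2)) := by ring
    _ ≤ Q * ((Q + s * p * (4 * (g + d + 2) + 1)) + s * p * (g + d + 2)) := by gcongr
    _ = _ := by ring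

end Count

section BaseChange

open Polynomial

theorem exists_irreducible_map_eq_pow_mul {k K : Type*} [Field k] [PerfectField k] [Field K]
    [Algebra k K] {P G' : k[X]} (hP : Irreducible P) (hG' : ¬ P ∣ G') (n : ℕ) :
    ∃ π G'' : K[X], Irreducible π ∧ (P ^ n * G').map (algebraMap k K) = π ^ n * G'' ∧
      ¬ π ∣ G'' := by
  have hdeg : ¬ IsUnit (P.map (algebraMap k K)) := by
    rw [isUnit_map]
    exact hP.not_isUnit
  obtain ⟨π, hπ, hdvd⟩ := WfDvdMonoid.exists_irreducible_factor hdeg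
    (Polynomial.map_ne_zero hP.ne_zero)
  obtain ⟨P', hP'⟩ := id hdvd
  have hsq : Squarefree (P.map (algebraMap k K)) :=
    ((PerfectField.separable_of_irreducible hP).map).squarefree
  have hcop : IsCoprime (P.map (algebraMap k K)) (G'.map (algebraMap k K)) :=
    (hP.coprime_iff_not_dvd.mpr hG').map (mapRingHom (algebraMap k K))
  refine ⟨π, P' ^ n * G'.map (algebraMap k K), hπ, ?_, fun h ↦ ?_⟩
  · rw [Polynomial.map_mul, Polynomial.map_pow, hP', mul_pow, mul_assoc]
  · rcases hπ.prime.dvd_or_dvd h with h | h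
    · refine hπ.not_isUnit (hsq π ?_)
      rw [hP']
      exact mul_dvd_mul_left _ (hπ.prime.dvd_of_dvd_pow h)
    · exact hπ.not_isUnit (hcop.isUnit_of_dvd' hdvd h)

end BaseChange

section TraceNormSum

open Polynomial

theorem norm_sum_mul_le_of_le {ι : Type*} (t : Finset ι) (f : ι → ℂ) (hf : ∀ i ∈ t, ‖f i‖ ≤ 1)
    (hf0 : ∑ i ∈ t, f i = 0) (n : ι → ℝ) {A E g : ℝ} (hE : 0 ≤ E) (hn : ∀ i ∈ t, n i ≤ A + E)
    (hsum : t.card * A - g ≤ ∑ i ∈ t, n i) :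
    ‖∑ i ∈ t, f i * (n i : ℂ)‖ ≤ 2 * t.card * E + g := by
  have h1 : ∑ i ∈ t, f i * (n i : ℂ) = ∑ i ∈ t, f i * ((n i - A : ℝ) : ℂ) := by
    simp_rw [Complex.ofReal_sub, mul_sub]
    rw [Finset.sum_sub_distrib, ← Finset.sum_mul, hf0, zero_mul, sub_zero]
  rw [h1]
  calc ‖∑ i ∈ t, f i * ((n i - A : ℝ) : ℂ)‖ ≤ ∑ i ∈ t, (2 * E - (n i - A)) := by
        refine norm_sum_le_of_le _ fun i hi ↦ ?_
        rw [norm_mul, Complex.norm_real, Real.norm_eq_abs]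
        have h2 : |n i - A| ≤ 2 * E - (n i - A) := by
          rw [abs_le]
          constructor <;> linarith [hn i hi]
        calc ‖f i‖ * |n i - A| ≤ 1 * |n i - A| := by
              gcongr
              exact hf i hi
          _ ≤ _ := by rwa [one_mul]
    _ = 2 * t.card * E + t.card * A - ∑ i ∈ t, n i := by
        simp only [Finset.sum_sub_distrib, Finset.sum_const, nsmul_eq_mul]
        ring
    _ ≤ _ := by linarith

theorem IsPrimitiveRoot.sum_nthRootsFinset_eq_zero {R : Type*} [CommRing R] [IsDomain R] {ζ : R}
    {n : ℕ} (h : IsPrimitiveRoot ζ n) (hn : 1 < n) : ∑ x ∈ nthRootsFinset n (1 : R), x = 0 := by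
  have h1 : ∑ x ∈ nthRootsFinset n (1 : R), ζ * x = ∑ x ∈ nthRootsFinset n (1 : R), x := by
    have hmem : ∀ k, ∀ x ∈ nthRootsFinset n (1 : R), ζ ^ k * x ∈ nthRootsFinset n (1 : R) := by
      intro k x hx
      rw [Polynomial.mem_nthRootsFinset (by omega)] at hx ⊢
      rw [mul_pow, hx, ← pow_mul, mul_comm k, pow_mul, h.pow_eq_one, one_pow, one_mul]
    have hinv : ζ ^ (n - 1) * ζ = 1 := by
      rw [← pow_succ, Nat.sub_add_cancel hn.le, h.pow_eq_one]
    refine Finset.sum_nbij' (ζ * ·) (ζ ^ (n - 1) * ·) (fun x hx ↦ ?_) (hmem _) ?_ ?_ ?_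
    · simpa using hmem 1 x hx
    · intro x _
      rw [← mul_assoc, hinv, one_mul]
    · intro x _
      rw [← mul_assoc, mul_comm ζ, hinv, one_mul]
    · exact fun _ _ ↦ rfl
  rw [← Finset.mul_sum] at h1
  have h2 : (ζ - 1) * ∑ x ∈ nthRootsFinset n (1 : R), x = 0 := by
    rw [sub_mul, one_mul, h1, sub_self]
  exact (mul_eq_zero.mp h2).resolve_left (sub_ne_zero.mpr (h.ne_one hn))

theorem MulChar.pow_eq_pow_of_apply_eq {k : Type*} [Field k] [Fintype k] (χ : MulChar k ℂ) {u v : k}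
    (hu : u ≠ 0) (hv : v ≠ 0) (h : χ u = χ v) :
    u ^ ((Fintype.card k - 1) / orderOf χ) = v ^ ((Fintype.card k - 1) / orderOf χ) := by
  classical
  obtain ⟨γ, hγ⟩ := IsCyclic.exists_monoid_generator (α := kˣ)
  lift u to kˣ using isUnit_iff_ne_zero.mpr hu
  lift v to kˣ using isUnit_iff_ne_zero.mpr hv
  obtain ⟨n, hn⟩ := hγ (u * v⁻¹)
  simp only at hn
  have huv : u = γ ^ n * v := by rw [hn, inv_mul_cancel_right]
  have h1 : χ γ ^ n = 1 := by
    rw [huv, Units.val_mul, map_mul, Units.val_pow_eq_pow_val, map_pow] at h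
    exact (mul_eq_right₀ (v.isUnit.map χ).ne_zero).mp h
  have h2 : χ ^ n = 1 := by
    refine MulChar.ext fun x ↦ ?_
    obtain ⟨l, rfl⟩ := hγ x
    rw [MulChar.one_apply_coe, MulChar.pow_apply_coe, Units.val_pow_eq_pow_val, map_pow, ← pow_mul,
      mul_comm, pow_mul, h1, one_pow]
  obtain ⟨r, hr⟩ := orderOf_dvd_of_pow_eq_one h2
  have h3 : γ ^ (n * ((Fintype.card k - 1) / orderOf χ)) = 1 := by
    rw [hr, mul_right_comm, Nat.mul_div_cancel' χ.orderOf_dvd_card_sub_one, pow_mul,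
      ← Fintype.card_units, pow_card_eq_one, one_pow]
  rw [huv]
  push_cast
  rw [mul_pow, ← pow_mul, ← Units.val_pow_eq_pow_val, h3, Units.val_one, one_mul]

end TraceNormSum

section TraceNormSum

open Polynomial

theorem norm_sum_trace_mul_norm_le {p : ℕ} [Fact p.Prime] {χ : MulChar (ZMod p) ℂ} (hχ : χ ≠ 1)
    {F G : (ZMod p)[X]} (hF0 : F.natDegree ≠ 0) (hF : F.natDegree < p) (hG0 : G ≠ 0)
    (hG : ∀ l : ℕ, l.Prime → l ∣ orderOf χ →
      ¬ ∃ (c : ZMod p) (H : (ZMod p)[X]), c ≠ 0 ∧ G = C c * H ^ l)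
    {φ : ZMod p → ℂ} (hφ : ∀ a, ‖φ a‖ ≤ 1) {m : ℕ}
    (hm : 4 * (orderOf χ * p) * (orderOf χ * G.natDegree + F.natDegree + 1) +
      (4 * (G.natDegree + F.natDegree + 2) + 1) ≤ p ^ m)
    (L : Type*) [Field L] [Fintype L] [Algebra (ZMod p) L]
    (hL : Module.finrank (ZMod p) L = 2 * m) :
    ‖∑ x : L, φ (Algebra.trace (ZMod p) L (aeval x F)) * χ (Algebra.norm (ZMod p) (aeval x G))‖ ≤
      (2 * (orderOf χ * p * (5 * (G.natDegree + F.natDegree) + 11)) + G.natDegree : ℝ) * p ^ m := by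
  classical
  have hp := (Fact.out : p.Prime)
  set s := orderOf χ with hs
  set g := G.natDegree with hg
  set d := F.natDegree with hd
  have hs0 : 0 < s := χ.orderOf_pos
  have hs1 : 1 < s := by
    have : s ≠ 1 := fun h ↦ hχ (orderOf_eq_one_iff.mp h)
    omega
  have hsp : s ∣ p - 1 := by
    have := χ.orderOf_dvd_card_sub_one
    rwa [ZMod.card] at this
  have : CharP L p := charP_of_injective_algebraMap (algebraMap (ZMod p) L).injective p
  have hcard : Fintype.card L = p ^ (2 * m) := by
    rw [Module.card_eq_pow_finrank (K := ZMod p), ZMod.card, hL]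
  have hω := Complex.isPrimitiveRoot_exp s hs0.ne'
  let key : L → ℂ × ZMod p := fun x ↦
    (χ (Algebra.norm (ZMod p) (aeval x G)), Algebra.trace (ZMod p) L (aeval x F))
  let S : Finset L := Finset.univ.filter fun x ↦ aeval x G ≠ 0
  let t : Finset (ℂ × ZMod p) := nthRootsFinset s (1 : ℂ) ×ˢ Finset.univ
  have hnorm : ∀ x ∈ S, Algebra.norm (ZMod p) (aeval x G) ≠ 0 := fun x hx ↦
    Algebra.norm_ne_zero_iff.mpr (Finset.mem_filter.mp hx).2
  have hkey : ∀ x ∈ S, key x ∈ t := by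
    intro x hx
    refine Finset.mem_product.mpr ⟨?_, Finset.mem_univ _⟩
    rw [Polynomial.mem_nthRootsFinset hs0]
    obtain ⟨ζ, h1, h2⟩ := χ.apply_mem_rootsOfUnity_orderOf (hnorm x hx)
    change χ (Algebra.norm (ZMod p) (aeval x G)) ^ s = 1
    rw [← h2, ← Units.val_pow_eq_pow_val, (mem_rootsOfUnity _ _).mp h1, Units.val_one]
  have ht : t.card = s * p := by
    rw [Finset.card_product, hω.card_nthRootsFinset, Finset.card_univ, ZMod.card]
  have hsum : ∑ x : L, φ (Algebra.trace (ZMod p) L (aeval x F)) *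
      χ (Algebra.norm (ZMod p) (aeval x G)) =
      ∑ i ∈ t, (i.1 * φ i.2) * (((S.filter fun x ↦ key x = i).card : ℝ) : ℂ) := by
    have h1 : ∑ x : L, φ (Algebra.trace (ZMod p) L (aeval x F)) *
        χ (Algebra.norm (ZMod p) (aeval x G)) = ∑ x ∈ S, (key x).1 * φ (key x).2 := by
      symm
      rw [Finset.sum_congr rfl fun x _ ↦ mul_comm (key x).1 _]
      refine Finset.sum_subset (Finset.subset_univ _) fun x _ hx ↦ ?_
      have : aeval x G = 0 := by simpa [S] using hx
      simp [key, this, MulChar.map_zero]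
    rw [h1, ← Finset.sum_fiberwise_of_maps_to hkey]
    refine Finset.sum_congr rfl fun i _ ↦ ?_
    rw [Finset.sum_congr rfl (g := fun _ ↦ i.1 * φ i.2)
      fun x hx ↦ by rw [(Finset.mem_filter.mp hx).2], Finset.sum_const, nsmul_eq_mul, mul_comm]
    simp
  have hSroots : p ^ (2 * m) ≤ S.card + g := by
    have h1 : (Finset.univ.filter fun x : L ↦ ¬ aeval x G ≠ 0).card ≤ g := by
      have hG0' : G.map (algebraMap (ZMod p) L) ≠ 0 := Polynomial.map_ne_zero hG0
      refine le_trans (Finset.card_le_card fun x hx ↦ ?_)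
        ((Multiset.toFinset_card_le _).trans ((card_roots' (G.map (algebraMap (ZMod p) L))).trans
          natDegree_map_le))
      rw [Multiset.mem_toFinset, mem_roots hG0', IsRoot, eval_map_algebraMap]
      simpa using hx
    have h2 := Finset.card_filter_add_card_filter_not (s := Finset.univ)
      (fun x : L ↦ aeval x G ≠ 0)
    rw [Finset.card_univ, hcard] at h2
    change S.card + _ = _ at h2
    omega
  have hScard : ∑ i ∈ t, (S.filter fun x ↦ key x = i).card = S.card :=
    (Finset.card_eq_sum_card_fiberwise hkey).symm
  have hcount : ∀ i ∈ t, s * p * (S.filter fun x ↦ key x = i).card ≤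
      p ^ (2 * m) + s * p * (5 * (g + d) + 11) * p ^ m := by
    intro i _
    rcases (S.filter fun x ↦ key x = i).eq_empty_or_nonempty with h | ⟨x₀, hx₀⟩
    · simp [h]
    have hpow : ∀ y : L, y ^ ((p ^ (2 * m) - 1) / s) =
        algebraMap (ZMod p) L (Algebra.norm (ZMod p) y ^ ((p - 1) / s)) := by
      intro y
      rw [map_pow, FiniteField.algebraMap_norm_eq_pow, ← pow_mul, Nat.card_eq_fintype_card,
        Nat.card_eq_fintype_card, hcard, ZMod.card]
      congr 1
      refine Nat.div_eq_of_eq_mul_right hs0 ?_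
      rw [mul_left_comm, Nat.mul_div_cancel' hsp, Nat.div_mul_cancel]
      simpa using Nat.sub_dvd_pow_sub_pow p 1 (2 * m)
    have := card_mul_le_of_forall_eval_pow_eq (s := s) (m := m) hs0.ne' hsp hcard
      (F := F.map (algebraMap (ZMod p) L)) (G := G.map (algebraMap (ZMod p) L))
      (by rwa [natDegree_map]) (by rwa [natDegree_map]) (fun l hl hls ↦ by
        obtain ⟨P, G', n, -, hP, hPG, hG', hn⟩ := exists_monic_irreducible_not_dvd hG0 (hG l hl hls)
        obtain ⟨π, G'', h1, h2, h3⟩ := exists_irreducible_map_eq_pow_mul (K := L) hP hG' n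
        exact ⟨π, G'', n, h1, hPG ▸ h2, h3, hn⟩) (Polynomial.map_ne_zero hG0)
      (by rwa [natDegree_map, natDegree_map])
      (algebraMap (ZMod p) L (Algebra.norm (ZMod p) (aeval x₀ G) ^ ((p - 1) / s)))
      (algebraMap (ZMod p) L i.2) (S.filter fun x ↦ key x = i) (fun x hx ↦ by
        have hxS := (Finset.mem_filter.mp hx).1
        have hxk := (Finset.mem_filter.mp hx).2
        have hxS₀ := (Finset.mem_filter.mp hx₀).1
        have hxk₀ := (Finset.mem_filter.mp hx₀).2
        simp only [eval_map_algebraMap]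
        refine ⟨(Finset.mem_filter.mp hxS).2, ?_, ?_⟩
        · rw [hpow]
          congr 1
          have h1 := χ.pow_eq_pow_of_apply_eq (hnorm x hxS) (hnorm x₀ hxS₀)
            (congrArg Prod.fst (hxk.trans hxk₀.symm))
          rwa [ZMod.card] at h1
        · rw [← hxk, FiniteField.algebraMap_trace_eq_sum_pow, hL, Nat.card_eq_fintype_card,
            ZMod.card])
    simpa only [natDegree_map] using this
  rw [hsum]
  have hsp0 : (0 : ℝ) < s * p := by
    have := hp.pos
    positivity
  have key2 := norm_sum_mul_le_of_le t (fun i ↦ i.1 * φ i.2) (fun i hi ↦ ?_) ?_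
    (fun i ↦ ((S.filter fun x ↦ key x = i).card : ℝ)) (A := (p : ℝ) ^ (2 * m) / (s * p))
    (E := (5 * (g + d) + 11) * (p : ℝ) ^ m) (g := g) (by positivity) (fun i hi ↦ ?_) ?_
  · refine key2.trans ?_
    rw [ht]
    have : (1 : ℝ) ≤ (p : ℝ) ^ m := one_le_pow₀ (by exact_mod_cast hp.one_le)
    have : (g : ℝ) * 1 ≤ g * (p : ℝ) ^ m := by gcongr
    push_cast
    nlinarith
  · rw [norm_mul]
    have h1 := (Polynomial.mem_nthRootsFinset hs0 1).mp (Finset.mem_product.mp hi).1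
    rw [Complex.norm_eq_one_of_pow_eq_one h1 hs0.ne', one_mul]
    exact hφ _
  · rw [Finset.sum_product]
    simp only [← Finset.mul_sum, ← Finset.sum_mul]
    rw [hω.sum_nthRootsFinset_eq_zero hs1, zero_mul]
  · have h1 : ((s * p * (S.filter fun x ↦ key x = i).card : ℕ) : ℝ) ≤
        (p ^ (2 * m) + s * p * (5 * (g + d) + 11) * p ^ m : ℕ) := Nat.cast_le.mpr (hcount i hi)
    push_cast at h1
    rw [← sub_le_iff_le_add, le_div_iff₀ hsp0]
    nlinarith
  · rw [ht]
    push_cast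
    rw [mul_div_cancel₀ _ hsp0.ne', ← Nat.cast_sum, hScard, sub_le_iff_le_add]
    exact_mod_cast hSroots

end TraceNormSum

section WeilBound

open Polynomial

theorem norm_sum_addChar_mul_mulChar_le_of_forall_prime {p : ℕ} [Fact p.Prime]
    (ψ : AddChar (ZMod p) ℂ) {χ : MulChar (ZMod p) ℂ} (hχ : χ ≠ 1) {F G : (ZMod p)[X]}
    (hF : F.natDegree < p) (hG0 : G ≠ 0)
    (hG : ∀ l : ℕ, l.Prime → l ∣ orderOf χ →
      ¬ ∃ (c : ZMod p) (H : (ZMod p)[X]), c ≠ 0 ∧ G = C c * H ^ l) :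
    ‖∑ u : ZMod p, ψ (F.eval u) * χ (G.eval u)‖ ≤
      ((F.natDegree : ℝ) +
        ({x : AlgebraicClosure (ZMod p) | aeval x G = 0}.ncard : ℝ) - 1) * √p := by
  have hp := (Fact.out : p.Prime)
  have hpow : ¬ ∃ (c : ZMod p) (H : (ZMod p)[X]), c ≠ 0 ∧ G = C c * H ^ orderOf χ := by
    rintro ⟨c, H, hc, h⟩
    obtain ⟨l, hl, hls⟩ := Nat.exists_prime_and_dvd fun h ↦ hχ (orderOf_eq_one_iff.mp h)
    refine hG l hl hls ⟨c, H ^ (orderOf χ / l), hc, ?_⟩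
    rw [← pow_mul, Nat.div_mul_cancel hls, h]
  have hψ : ∀ a, ‖ψ a‖ ≤ 1 := fun a ↦ (ψ.norm_apply a).le
  let C₀ (d : ℕ) : ℝ := 2 * (orderOf χ * p * (5 * (G.natDegree + d) + 11)) + G.natDegree
  let m₀ (d : ℕ) : ℕ := 4 * (orderOf χ * p) * (orderOf χ * G.natDegree + d + 1) +
    (4 * (G.natDegree + d + 2) + 1)
  have hlarge : ∀ {W m : ℕ}, W ≤ m → W ≤ p ^ m := fun h ↦
    h.trans (Nat.lt_pow_self hp.one_lt).le
  by_cases hF0 : F.natDegree = 0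
  · have hX : (X : (ZMod p)[X]).natDegree = 1 := natDegree_X
    refine norm_sum_addChar_mul_mulChar_le ψ χ hG0 hpow (C₀ (X : (ZMod p)[X]).natDegree)
      (m₀ (X : (ZMod p)[X]).natDegree) fun m hm L _ _ _ hL ↦ ?_
    obtain ⟨b, rfl⟩ := natDegree_eq_zero.mp hF0
    have := norm_sum_trace_mul_norm_le hχ (F := X) (by rw [hX]; exact one_ne_zero)
      (by rw [hX]; exact hp.one_lt) hG0 hG (φ := fun _ ↦ ψ (2 * m * b)) (fun _ ↦ hψ _) (hlarge hm)
      L hL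
    refine le_trans (le_of_eq ?_) this
    congr 2 with x
    rw [aeval_C, Algebra.trace_algebraMap, hL, nsmul_eq_mul]
    push_cast
    rfl
  · exact norm_sum_addChar_mul_mulChar_le ψ χ hG0 hpow (C₀ F.natDegree) (m₀ F.natDegree) fun m hm L _ _ _ hL ↦
      norm_sum_trace_mul_norm_le hχ hF0 hF hG0 hG hψ (hlarge hm) L hL

theorem norm_sum_addChar_mul_mulChar_le_of_natDegree_lt {p : ℕ} [Fact p.Prime]
    (ψ : AddChar (ZMod p) ℂ) {χ : MulChar (ZMod p) ℂ} (hχ : χ ≠ 1) {F G : (ZMod p)[X]}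
    (hF : F.natDegree < p) (hG0 : G ≠ 0)
    (hG : ¬ ∃ (c : ZMod p) (H : (ZMod p)[X]), c ≠ 0 ∧ G = C c * H ^ orderOf χ) :
    ‖∑ u : ZMod p, ψ (F.eval u) * χ (G.eval u)‖ ≤
      ((F.natDegree : ℝ) +
        ({x : AlgebraicClosure (ZMod p) | aeval x G = 0}.ncard : ℝ) - 1) * √p := by
  induction hs : orderOf χ using Nat.strong_induction_on generalizing χ G with
  | _ s ih =>
    subst hs
    by_cases hall : ∀ l : ℕ, l.Prime → l ∣ orderOf χ →
        ¬ ∃ (c : ZMod p) (H : (ZMod p)[X]), c ≠ 0 ∧ G = C c * H ^ l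
    · exact norm_sum_addChar_mul_mulChar_le_of_forall_prime ψ hχ hF hG0 hall
    push Not at hall
    obtain ⟨l, hl, hls, c, H, hc, rfl⟩ := hall
    have hH0 : H ≠ 0 := by
      rintro rfl
      simp [hl.ne_zero] at hG0
    have hord : orderOf (χ ^ l) = orderOf χ / l := orderOf_pow_of_dvd hl.ne_zero hls
    have hχl : χ ^ l ≠ 1 := by
      intro h
      have h1 := orderOf_dvd_of_pow_eq_one h
      exact hG ⟨c, H, hc, by rw [Nat.dvd_antisymm h1 hls]⟩
    have hHpow : ¬ ∃ (c : ZMod p) (H' : (ZMod p)[X]), c ≠ 0 ∧ H = C c * H' ^ orderOf (χ ^ l) := by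
      rintro ⟨b, H', hb, rfl⟩
      refine hG ⟨c * b ^ l, H', mul_ne_zero hc (pow_ne_zero _ hb), ?_⟩
      rw [mul_pow, ← pow_mul, hord, Nat.div_mul_cancel hls, C_mul, C_pow, mul_assoc]
    have hroots : {x : AlgebraicClosure (ZMod p) | aeval x (C c * H ^ l) = 0} =
        {x | aeval x H = 0} := by
      ext x
      simp [hc, hl.ne_zero]
    have hχc : ‖χ c‖ ≤ 1 := by
      obtain ⟨ζ, h1, h2⟩ := χ.apply_mem_rootsOfUnity_orderOf hc
      rw [← h2]
      refine (Complex.norm_eq_one_of_pow_eq_one (n := orderOf χ) ?_ χ.orderOf_pos.ne').le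
      rw [← Units.val_pow_eq_pow_val, (mem_rootsOfUnity _ _).mp h1, Units.val_one]
    have hsum : ∑ u : ZMod p, ψ (F.eval u) * χ ((C c * H ^ l).eval u) =
        χ c * ∑ u : ZMod p, ψ (F.eval u) * (χ ^ l) (H.eval u) := by
      rw [Finset.mul_sum]
      refine Finset.sum_congr rfl fun u _ ↦ ?_
      rw [eval_mul, eval_C, eval_pow, map_mul, map_pow, χ.pow_apply' hl.ne_zero]
      ring
    rw [hsum, hroots, norm_mul]
    have := ih _ (hord ▸ Nat.div_lt_self χ.orderOf_pos hl.one_lt) hχl hH0 hHpow rfl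
    exact (mul_le_of_le_one_left (norm_nonneg _) hχc).trans this

end WeilBound

/-- Weil bound for mixed character sums: Let `p` be a prime, `χ` a
nontrivial multiplicative character of `F_p` of order `s`, and `G ∈ F_p[X]` a
nonzero polynomial which is not, up to a nonzero multiplicative constant, an
`s`-th power in `F_p[X]`; let `ν` be the number of distinct roots of `G` in an
algebraic closure of `F_p`.  Then for any polynomial `F ∈ F_p[X]` of degree
`d < p`, `|Σ_{u ∈ F_p} e_p(F(u)) χ(G(u))| ≤ (d + ν − 1) √p`. -/
theorem weil_bound_mixed_character_sum
    (p : ℕ) [Fact p.Prime]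
    (χ : MulChar (ZMod p) ℂ) (s : ℕ) (hχ : χ ≠ 1) (hs : orderOf χ = s)
    (G : Polynomial (ZMod p)) (hG0 : G ≠ 0)
    (hGpow : ¬ ∃ (c : ZMod p) (H : Polynomial (ZMod p)),
      c ≠ 0 ∧ G = Polynomial.C c * H ^ s)
    (ν : ℕ)
    (hν : ν = {x : AlgebraicClosure (ZMod p) | (Polynomial.aeval x) G = 0}.ncard)
    (F : Polynomial (ZMod p)) (d : ℕ) (hd : F.natDegree = d) (hdp : d < p) :
    ‖∑ u : ZMod p, eZMod p (F.eval u) * χ (G.eval u)‖ ≤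
      ((d : ℝ) + (ν : ℝ) - 1) * Real.sqrt p := by
  subst hs hν hd
  have he : ∀ z : ZMod p, eZMod p z = ZMod.stdAddChar z := fun z ↦ by
    rw [eZMod, ZMod.stdAddChar_apply, ZMod.toCircle_apply]
  simp_rw [he]
  exact norm_sum_addChar_mul_mulChar_le_of_natDegree_lt _ hχ hdp hG0 hGpow
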